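/- Let r_1,…,r_6 be any six unit vectors in ℝ³ and let g be a standard Gaussian random vector in ℝ³. Then E max_{1≤i≤6} ⟨g, r_i⟩ ≤ E max_{v ∈ O} ⟨g, v⟩, where O = {±e_1, ±e_2, ±e_3} is the vertex set of the regular octahedron inscribed in the unit sphere: among all convex hulls of at most six points of S², the regular octahedron maximizes the Gaussian mean width. -/

import Mathlib

open MeasureTheory ProbabilityTheory Matrix

noncomputable section

/-- The vertices `±e₁, ±e₂, ±e₃` of the regular octahedron inscribed in the unit
sphere of `ℝ³`. -/
def octaVertex (p : Fin 3 × Bool) : Fin 3 → ℝ :=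
  fun k => if k = p.1 then (if p.2 then 1 else -1) else 0

open Real in
theorem arctanRatio_monotoneOn :
    MonotoneOn (fun x : ℝ => (1 + x ^ 2) * arctan x / x) (Set.Ioi 0) := by
  have hd : ∀ x : ℝ, 0 < x → HasDerivAt (fun x : ℝ => (1 + x ^ 2) * arctan x / x)
      ((x - (1 - x ^ 2) * arctan x) / x ^ 2) x := by
    intro x hx
    have h1 : HasDerivAt (fun x : ℝ => 1 + x ^ 2) (2 * x) x := by
      simpa using (hasDerivAt_pow 2 x).const_add 1
    have h := (h1.mul (hasDerivAt_arctan x)).div (hasDerivAt_id x) hx.ne'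
    refine HasDerivAt.congr_deriv h ?_
    simp only [id, Pi.mul_apply]
    field_simp
    ring
  refine monotoneOn_of_deriv_nonneg (convex_Ioi 0)
    (fun x hx => (hd x hx).continuousAt.continuousWithinAt)
    (fun x hx => (hd x (by simpa using hx)).differentiableAt.differentiableWithinAt) ?_
  intro x hx
  have hx : 0 < x := by simpa using hx
  rw [(hd x hx).deriv]
  have h0 : 0 ≤ arctan x := arctan_nonneg.2 hx.le
  have h1 : arctan x ≤ x := by
    have := le_tan h0 (arctan_lt_pi_div_two x)
    rwa [tan_arctan] at this
  apply div_nonneg _ (sq_nonneg x)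
  nlinarith [mul_nonneg (sq_nonneg x) h0]

/-- The lower root of `cosDefect` as a function of the cosine. -/
def loCos : ℝ := (√3)⁻¹

/-- The upper root of `cosDefect` as a function of the cosine. -/
def hiCos : ℝ := (√3)⁻¹ * ((1 + (√2)⁻¹ ^ 2) * Real.arctan (√2)⁻¹ / (√2)⁻¹)

/-- The cosine of the angle with cotangent `k`. -/
def cosOfCot (k : ℝ) : ℝ := k / √(1 + k ^ 2)

/-- The integrand whose integral over a half circle is maximized by the octahedron. -/
def cosDefect (k : ℝ) : ℝ := (cosOfCot k - loCos) * (hiCos - cosOfCot k)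

/-- The integral of `cosDefect` along the positive part of the half circle of radius
`√((1 + x ^ 2) / (2 - x ^ 2))`, in closed form. -/
def arcValue (x : ℝ) : ℝ :=
  √((2 - x ^ 2) / 3) * Real.arctan x + (hiCos + loCos) * Real.arcsin (x / √2)
    - (1 + loCos * hiCos) * Real.arctan (√3 * x / √(2 - x ^ 2))

theorem hasDerivAt_arcValue {x : ℝ} (hx : 0 < x) (hx2 : x ^ 2 < 2) :
    HasDerivAt arcValue (x ^ 2 / ((1 + x ^ 2) * √(2 - x ^ 2)) *
      (hiCos - (√3)⁻¹ * ((1 + x ^ 2) * Real.arctan x / x))) x := by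
  have hw : 0 < 2 - x ^ 2 := by linarith
  have h3 : (√3 : ℝ) ^ 2 = 3 := Real.sq_sqrt (by norm_num)
  have h2 : (√2 : ℝ) ^ 2 = 2 := Real.sq_sqrt (by norm_num)
  have h3p : 0 < √3 := by positivity
  have h2p : 0 < √2 := by positivity
  obtain ⟨w, hwdef⟩ : ∃ w, w = √(2 - x ^ 2) := ⟨_, rfl⟩
  have hw2 : w ^ 2 = 2 - x ^ 2 := by rw [hwdef, Real.sq_sqrt hw.le]
  have hwp : 0 < w := by rw [hwdef]; positivity
  have hsq : HasDerivAt (fun x : ℝ => 2 - x ^ 2) (-(2 * x)) x := by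
    simpa using (hasDerivAt_pow 2 x).const_sub 2
  have hs : HasDerivAt (fun x : ℝ => √(2 - x ^ 2)) (-(x / w)) x := by
    convert hsq.sqrt hw.ne' using 1
    rw [← hwdef]; field_simp
  have e1' : ∀ x : ℝ, √((2 - x ^ 2) / 3) = √(2 - x ^ 2) / √3 := fun x => by
    rw [Real.sqrt_div' _ (by norm_num)]
  have t1 : HasDerivAt (fun x : ℝ => √((2 - x ^ 2) / 3) * Real.arctan x)
      (-(x / w) / √3 * Real.arctan x + w / √3 * (1 / (1 + x ^ 2))) x := by
    have := (hs.div_const √3).mul (Real.hasDerivAt_arctan x)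
    rw [← hwdef] at this
    simp only [e1']
    exact this
  have hlt : x / √2 < 1 := by
    rw [div_lt_one h2p]; nlinarith
  have t2 : HasDerivAt (fun x : ℝ => Real.arcsin (x / √2)) (1 / w) x := by
    have hq : √(1 - (x / √2) ^ 2) = w / √2 := by
      rw [div_pow, h2, show 1 - x ^ 2 / 2 = (2 - x ^ 2) / 2 by ring, hwdef,
        Real.sqrt_div' _ (by norm_num)]
    have := (Real.hasDerivAt_arcsin (x := x / √2) (by have : 0 < x / √2 := by positivity
                                                      linarith) hlt.ne).comp x
      ((hasDerivAt_id x).div_const √2)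
    rw [hq] at this
    refine HasDerivAt.congr_deriv this ?_
    field_simp
  have t3 : HasDerivAt (fun x : ℝ => Real.arctan (√3 * x / √(2 - x ^ 2)))
      (√3 / (w * (1 + x ^ 2))) x := by
    have := (((hasDerivAt_id x).const_mul √3).div hs (hwdef ▸ hwp.ne')).arctan
    refine HasDerivAt.congr_deriv this ?_
    simp only [id, Pi.div_apply]
    rw [← hwdef]
    have h4 : 1 + (√3 * x / w) ^ 2 = 2 * (1 + x ^ 2) / w ^ 2 := by
      field_simp; rw [h3, hw2]; ring
    rw [h4]
    have : √3 * 1 * w - √3 * x * -(x / w) = √3 * 2 / w := by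
      field_simp; rw [hw2]; ring
    rw [this]
    field_simp
  have := (t1.add (t2.const_mul (hiCos + loCos))).sub (t3.const_mul (1 + loCos * hiCos))
  refine HasDerivAt.congr_deriv this ?_
  rw [← hwdef, loCos]
  field_simp
  ring_nf
  simp only [h3, hw2]
  ring

theorem arcValue_le {x : ℝ} (hx : 0 ≤ x) (hx2 : x ^ 2 < 2) :
    arcValue x ≤ arcValue (√2)⁻¹ := by
  have h2 : (√2 : ℝ) ^ 2 = 2 := Real.sq_sqrt (by norm_num)
  have h2p : 0 < √2 := by positivity
  have hx0 : ((√2)⁻¹ : ℝ) ^ 2 = 1 / 2 := by rw [inv_pow, h2]; norm_num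
  have hx0p : (0 : ℝ) < (√2)⁻¹ := by positivity
  have hcont : ContinuousOn arcValue (Set.Ico 0 √2) := by
    unfold arcValue
    intro z hz
    have : √(2 - z ^ 2) ≠ 0 := (Real.sqrt_pos.2 (by nlinarith [hz.1, hz.2])).ne'
    apply ContinuousAt.continuousWithinAt
    fun_prop (disch := assumption)
  have hxlt : x < √2 := by nlinarith
  have h0lt : (√2)⁻¹ < √2 := by nlinarith
  have key : ∀ z : ℝ, 0 < z → z ^ 2 < 2 → 0 ≤ z ^ 2 / ((1 + z ^ 2) * √(2 - z ^ 2)) := by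
    intros; positivity
  rcases le_total x (√2)⁻¹ with h | h
  · refine (monotoneOn_of_deriv_nonneg (convex_Icc 0 (√2)⁻¹)
      (hcont.mono fun z hz => ⟨hz.1, hz.2.trans_lt h0lt⟩) ?_ ?_) ⟨hx, h⟩ ⟨hx0p.le, le_rfl⟩ h
    · intro z hz
      rw [interior_Icc] at hz
      exact (hasDerivAt_arcValue hz.1
        (by nlinarith [hz.1, hz.2])).differentiableAt.differentiableWithinAt
    · intro z hz
      rw [interior_Icc] at hz
      have hz2 : z ^ 2 < 2 := by nlinarith [hz.1, hz.2]
      rw [(hasDerivAt_arcValue hz.1 hz2).deriv]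
      refine mul_nonneg (key z hz.1 hz2) (sub_nonneg.2 ?_)
      exact mul_le_mul_of_nonneg_left
        (arctanRatio_monotoneOn hz.1 hx0p hz.2.le) (by positivity)
  · refine (antitoneOn_of_deriv_nonpos (convex_Ico (√2)⁻¹ √2)
      (hcont.mono fun z hz => ⟨hx0p.le.trans hz.1, hz.2⟩) ?_ ?_) ⟨le_rfl, h0lt⟩ ⟨h, hxlt⟩ h
    · intro z hz
      rw [interior_Ico] at hz
      have hz0 := hx0p.trans hz.1
      exact (hasDerivAt_arcValue hz0 (by nlinarith [hz.2])).differentiableAt.differentiableWithinAt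
    · intro z hz
      rw [interior_Ico] at hz
      have hz0 := hx0p.trans hz.1
      have hz2 : z ^ 2 < 2 := by nlinarith [hz.2]
      rw [(hasDerivAt_arcValue hz0 hz2).deriv]
      refine mul_nonpos_of_nonneg_of_nonpos (key z hz0 hz2) (sub_nonpos.2 ?_)
      exact mul_le_mul_of_nonneg_left
        (arctanRatio_monotoneOn hx0p hz0 hz.1.le) (by positivity)

theorem continuous_cosOfCot : Continuous cosOfCot := by
  unfold cosOfCot
  exact continuous_id.div (by fun_prop) fun k => (Real.sqrt_pos.2 (by positivity)).ne'

theorem continuous_cosDefect : Continuous cosDefect := by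
  unfold cosDefect
  have := continuous_cosOfCot
  fun_prop

theorem cosOfCot_sq (k : ℝ) : cosOfCot k ^ 2 = 1 - 1 / (1 + k ^ 2) := by
  have : 0 < 1 + k ^ 2 := by positivity
  rw [cosOfCot, div_pow, Real.sq_sqrt this.le]
  field_simp
  ring

theorem cosOfCot_lt_one (k : ℝ) : cosOfCot k < 1 := by
  have h := cosOfCot_sq k
  have : 0 < 1 / (1 + k ^ 2) := by positivity
  nlinarith

theorem cosOfCot_mono : Monotone cosOfCot := by
  intro a b hab
  rw [cosOfCot, cosOfCot, div_le_div_iff₀ (by positivity) (by positivity)]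
  rcases le_total 0 a with ha | ha
  · have hb := ha.trans hab
    apply (pow_le_pow_iff_left₀ (by positivity) (by positivity) two_ne_zero).1
    rw [mul_pow, mul_pow, Real.sq_sqrt (by positivity), Real.sq_sqrt (by positivity)]
    nlinarith
  · rcases le_total 0 b with hb | hb
    · exact (mul_nonpos_of_nonpos_of_nonneg ha (by positivity)).trans (by positivity)
    · suffices -b * √(1 + a ^ 2) ≤ -a * √(1 + b ^ 2) by linarith
      have h1 : 0 ≤ -b := by linarith
      have h2 : 0 ≤ -a := by linarith
      apply (pow_le_pow_iff_left₀ (by positivity) (by positivity) two_ne_zero).1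
      rw [mul_pow, mul_pow, Real.sq_sqrt (by positivity), Real.sq_sqrt (by positivity)]
      nlinarith

theorem cosOfCot_inv_sqrt_two : cosOfCot (√2)⁻¹ = loCos := by
  have h : 1 + ((√2 : ℝ)⁻¹) ^ 2 = 3 / 2 := by
    rw [inv_pow, Real.sq_sqrt (by norm_num)]; norm_num
  rw [cosOfCot, h, Real.sqrt_div (by norm_num), loCos]
  field_simp

theorem loCos_pos : 0 < loCos := by unfold loCos; positivity

theorem loCos_le_hiCos : loCos ≤ hiCos := by
  have h2 : ((√2 : ℝ)⁻¹) ^ 2 = 1 / 2 := by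
    rw [inv_pow, Real.sq_sqrt (by norm_num)]; norm_num
  have hp : (0 : ℝ) < (√2)⁻¹ := by positivity
  set s := (√2 : ℝ)⁻¹
  have h0 : 0 < Real.arctan s := Real.arctan_pos.2 hp
  have h : s / √(1 + s ^ 2) ≤ Real.arctan s := by
    rw [← Real.sin_arctan]; exact Real.sin_le h0.le
  have h1 : s / (1 + s ^ 2) ≤ s / √(1 + s ^ 2) := by
    apply div_le_div_of_nonneg_left hp.le (by positivity)
    rw [Real.sqrt_le_left (by positivity)]
    nlinarith
  rw [loCos, hiCos]
  refine le_mul_of_one_le_right (by positivity) ?_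
  rw [one_le_div hp]
  have := h1.trans h
  rwa [div_le_iff₀ (by positivity), mul_comm] at this

theorem cosDefect_nonpos_of_le {k : ℝ} (hk : k ≤ (√2)⁻¹) : cosDefect k ≤ 0 := by
  have h := cosOfCot_mono hk
  rw [cosOfCot_inv_sqrt_two] at h
  exact mul_nonpos_of_nonpos_of_nonneg (by linarith) (by linarith [loCos_le_hiCos])

theorem cosDefect_nonneg {k : ℝ} (hk : (√2)⁻¹ ≤ k) (hk' : cosOfCot k ≤ hiCos) :
    0 ≤ cosDefect k := by
  have h := cosOfCot_mono hk
  rw [cosOfCot_inv_sqrt_two] at h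
  exact mul_nonneg (by linarith) (by linarith)

theorem cosDefect_nonpos_of_hiCos_le {k : ℝ} (hk : hiCos ≤ cosOfCot k) : cosDefect k ≤ 0 :=
  mul_nonpos_of_nonneg_of_nonpos (by linarith [loCos_le_hiCos]) (by linarith)

/-- An antiderivative of `cosDefect` along a half circle of radius `R`. -/
def arcPrimitive (R θ : ℝ) : ℝ :=
  (√(1 + R ^ 2))⁻¹ * Real.arctan ((√(1 + R ^ 2))⁻¹ * Real.tan θ)
    + (hiCos + loCos) * Real.arcsin (R / √(1 + R ^ 2) * Real.sin θ) - (1 + loCos * hiCos) * θ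

theorem hasDerivAt_arcPrimitive (R : ℝ) {θ : ℝ} (hc : 0 < Real.cos θ) :
    HasDerivAt (arcPrimitive R) (cosDefect (R * Real.cos θ)) θ := by
  obtain ⟨S, hSdef⟩ : ∃ S, S = √(1 + R ^ 2) := ⟨_, rfl⟩
  have hS2 : S ^ 2 = 1 + R ^ 2 := by rw [hSdef, Real.sq_sqrt (by positivity)]
  have hSp : 0 < S := by rw [hSdef]; positivity
  have hsc := Real.sin_sq_add_cos_sq θ
  obtain ⟨T, hTdef⟩ : ∃ T, T = √(1 + (R * Real.cos θ) ^ 2) := ⟨_, rfl⟩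
  have hT2 : T ^ 2 = 1 + (R * Real.cos θ) ^ 2 := by rw [hTdef, Real.sq_sqrt (by positivity)]
  have hTp : 0 < T := by rw [hTdef]; positivity
  have hlt : (R / S * Real.sin θ) ^ 2 < 1 := by
    rw [mul_pow, div_pow, hS2, div_mul_eq_mul_div, div_lt_one (by positivity)]
    nlinarith [mul_nonneg (sq_nonneg R) (sq_nonneg (Real.cos θ))]
  have hlt' := abs_lt.1 ((sq_lt_one_iff_abs_lt_one _).1 hlt)
  have t1 := (((Real.hasDerivAt_tan hc.ne').const_mul S⁻¹).arctan).const_mul S⁻¹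
  have t2 := ((Real.hasDerivAt_arcsin hlt'.1.ne' hlt'.2.ne).comp θ
    ((Real.hasDerivAt_sin θ).const_mul (R / S))).const_mul (hiCos + loCos)
  have t3 := (hasDerivAt_id θ).const_mul (1 + loCos * hiCos)
  have e : arcPrimitive R = fun θ => S⁻¹ * Real.arctan (S⁻¹ * Real.tan θ)
    + (hiCos + loCos) * Real.arcsin (R / S * Real.sin θ) - (1 + loCos * hiCos) * θ := by
    rw [hSdef]; rfl
  rw [e]
  refine ((t1.add t2).sub t3).congr_deriv ?_
  have hq : √(1 - (R / S * Real.sin θ) ^ 2) = T / S := by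
    rw [Real.sqrt_eq_iff_mul_self_eq_of_pos (by positivity)]
    field_simp
    rw [hT2, hS2]
    linear_combination R ^ 2 * hsc
  have e1 : S⁻¹ * (1 / (1 + (S⁻¹ * Real.tan θ) ^ 2) * (S⁻¹ * (1 / Real.cos θ ^ 2))) =
      1 / T ^ 2 := by
    rw [Real.tan_eq_sin_div_cos]
    have : 0 < S ^ 2 * Real.cos θ ^ 2 + Real.sin θ ^ 2 := by positivity
    field_simp
    rw [hT2, hS2]
    linear_combination -hsc
  rw [e1, hq, cosDefect, cosOfCot, ← hTdef]
  field_simp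
  linear_combination -hT2

theorem integral_cosDefect_eq_arcValue {R : ℝ} (hR : (√2)⁻¹ ≤ R) :
    ∫ θ in (0 : ℝ)..Real.arctan √(2 * R ^ 2 - 1), cosDefect (R * Real.cos θ) =
      arcValue (√((2 * R ^ 2 - 1) / (1 + R ^ 2))) := by
  have hR0 : 0 < R := lt_of_lt_of_le (by positivity) hR
  have h2 : ((√2 : ℝ)⁻¹) ^ 2 = 1 / 2 := by
    rw [inv_pow, Real.sq_sqrt (by norm_num)]; norm_num
  have ht : 0 ≤ 2 * R ^ 2 - 1 := by
    have : ((√2 : ℝ)⁻¹) ^ 2 ≤ R ^ 2 := by gcongr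
    linarith
  rw [intervalIntegral.integral_eq_sub_of_hasDerivAt (f := arcPrimitive R)]
  · obtain ⟨t, htdef⟩ : ∃ t, t = √(2 * R ^ 2 - 1) := ⟨_, rfl⟩
    have ht2 : t ^ 2 = 2 * R ^ 2 - 1 := by rw [htdef, Real.sq_sqrt ht]
    obtain ⟨S, hSdef⟩ : ∃ S, S = √(1 + R ^ 2) := ⟨_, rfl⟩
    have hS2 : S ^ 2 = 1 + R ^ 2 := by rw [hSdef, Real.sq_sqrt (by positivity)]
    have hSp : 0 < S := by rw [hSdef]; positivity
    have hw : 2 - (t / S) ^ 2 = 3 / S ^ 2 := by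
      field_simp; rw [ht2, hS2]; ring
    rw [Real.sqrt_div ht, ← htdef, ← hSdef, arcPrimitive, arcPrimitive, arcValue, ← hSdef, hw,
      Real.tan_arctan, Real.sin_arctan, ht2, show 1 + (2 * R ^ 2 - 1) = 2 * R ^ 2 by ring,
      Real.sqrt_mul (by norm_num), Real.sqrt_sq hR0.le, show 3 / S ^ 2 / 3 = S⁻¹ ^ 2 by field_simp,
      Real.sqrt_sq (by positivity), Real.sqrt_div (by norm_num), Real.sqrt_sq hSp.le,
      show √3 * (t / S) / (√3 / S) = t by field_simp,
      show R / S * (t / (√2 * R)) = t / S / √2 by field_simp]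
    simp [div_eq_inv_mul]
  · intro θ hθ
    apply hasDerivAt_arcPrimitive
    have h0 : 0 ≤ Real.arctan √(2 * R ^ 2 - 1) := Real.arctan_nonneg.2 (Real.sqrt_nonneg _)
    rw [Set.uIcc_of_le h0] at hθ
    exact Real.cos_pos_of_mem_Ioo ⟨by linarith [hθ.1, Real.pi_pos],
      hθ.2.trans_lt (Real.arctan_lt_pi_div_two _)⟩
  · have := continuous_cosDefect
    exact (by fun_prop : Continuous fun θ => cosDefect (R * Real.cos θ)).intervalIntegrable _ _

/-- The contribution of a half edge of the octahedron. -/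
def halfEdge : ℝ := arcValue (√2)⁻¹

theorem halfEdge_nonneg : 0 ≤ halfEdge := by
  have := arcValue_le le_rfl (by norm_num)
  simpa [arcValue, halfEdge] using this

theorem integral_cosDefect_one :
    ∫ θ in (0 : ℝ)..Real.pi / 4, cosDefect (Real.cos θ) = halfEdge := by
  have := integral_cosDefect_eq_arcValue (R := 1)
    (inv_le_one_of_one_le₀ (Real.one_le_sqrt.2 (by norm_num)))
  norm_num at this
  rw [halfEdge, ← this]

theorem integral_posPart_cosDefect_le_of_le {R : ℝ} (hR : (√2)⁻¹ ≤ R) (hy : cosOfCot R ≤ hiCos) :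
    ∫ θ in (0 : ℝ)..Real.pi / 2, max (cosDefect (R * Real.cos θ)) 0 ≤ halfEdge := by
  have hR0 : 0 < R := lt_of_lt_of_le (by positivity) hR
  have h2 : ((√2 : ℝ)⁻¹) ^ 2 = 1 / 2 := by
    rw [inv_pow, Real.sq_sqrt (by norm_num)]; norm_num
  have ht : 0 ≤ 2 * R ^ 2 - 1 := by
    have : ((√2 : ℝ)⁻¹) ^ 2 ≤ R ^ 2 := by gcongr
    linarith
  have hc := continuous_cosDefect
  have hi : ∀ a b, IntervalIntegrable (fun θ => max (cosDefect (R * Real.cos θ)) 0) volume a b :=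
    fun a b => (by fun_prop : Continuous fun θ =>
      max (cosDefect (R * Real.cos θ)) 0).intervalIntegrable a b
  set β := Real.arctan √(2 * R ^ 2 - 1) with hβ
  have hβ0 : 0 ≤ β := Real.arctan_nonneg.2 (Real.sqrt_nonneg _)
  have hβ1 : β < Real.pi / 2 := Real.arctan_lt_pi_div_two _
  have hcos : R * Real.cos β = (√2)⁻¹ := by
    rw [hβ, Real.cos_arctan, Real.sq_sqrt ht, show 1 + (2 * R ^ 2 - 1) = 2 * R ^ 2 by ring,
      Real.sqrt_mul (by norm_num), Real.sqrt_sq hR0.le]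
    field_simp
  rw [← intervalIntegral.integral_add_adjacent_intervals (hi 0 β) (hi β _)]
  have e1 : ∫ θ in (0 : ℝ)..β, max (cosDefect (R * Real.cos θ)) 0 =
      ∫ θ in (0 : ℝ)..β, cosDefect (R * Real.cos θ) := by
    apply intervalIntegral.integral_congr
    intro θ hθ
    rw [Set.uIcc_of_le hβ0] at hθ
    refine max_eq_left (cosDefect_nonneg ?_ ((cosOfCot_mono ?_).trans hy))
    · rw [← hcos]
      exact mul_le_mul_of_nonneg_left (Real.cos_le_cos_of_nonneg_of_le_pi hθ.1
        (by linarith [Real.pi_pos]) hθ.2) hR0.le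
    · exact mul_le_of_le_one_right hR0.le (Real.cos_le_one θ)
  have e2 : ∫ θ in β..(Real.pi / 2), max (cosDefect (R * Real.cos θ)) 0 =
      ∫ θ in β..(Real.pi / 2), (0 : ℝ) := by
    apply intervalIntegral.integral_congr
    intro θ hθ
    rw [Set.uIcc_of_le hβ1.le] at hθ
    refine max_eq_right (cosDefect_nonpos_of_le ?_)
    rw [← hcos]
    exact mul_le_mul_of_nonneg_left (Real.cos_le_cos_of_nonneg_of_le_pi hβ0
        (by linarith [Real.pi_pos, hθ.2]) hθ.1) hR0.le
  rw [e1, e2, integral_cosDefect_eq_arcValue hR, intervalIntegral.integral_zero, add_zero]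
  apply arcValue_le (Real.sqrt_nonneg _)
  rw [Real.sq_sqrt (by positivity), div_lt_iff₀ (by positivity)]
  linarith

theorem integral_posPart_cosDefect_le_rescale {K R : ℝ} (hK : 0 < K) (hKR : K < R)
    (hy : hiCos ≤ cosOfCot K) :
    ∫ θ in (0 : ℝ)..Real.pi / 2, max (cosDefect (R * Real.cos θ)) 0 ≤
      ∫ θ in (0 : ℝ)..Real.pi / 2, max (cosDefect (K * Real.cos θ)) 0 := by
  have hR0 : 0 < R := hK.trans hKR
  obtain ⟨c, hcdef⟩ : ∃ c, c = K / R := ⟨_, rfl⟩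
  have hc0 : 0 < c := by rw [hcdef]; positivity
  have hc1 : c < 1 := by rw [hcdef, div_lt_one hR0]; exact hKR
  have hRc : R * c = K := by rw [hcdef]; field_simp
  have hc := continuous_cosDefect
  have hi : ∀ a b, IntervalIntegrable (fun θ => max (cosDefect (R * Real.cos θ)) 0) volume a b :=
    fun a b => (by fun_prop : Continuous fun θ =>
      max (cosDefect (R * Real.cos θ)) 0).intervalIntegrable a b
  have hβ0 : 0 ≤ Real.arccos c := Real.arccos_nonneg c
  rw [← intervalIntegral.integral_add_adjacent_intervals (hi 0 (Real.arccos c)) (hi _ _)]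
  have e1 : ∫ θ in (0 : ℝ)..Real.arccos c, max (cosDefect (R * Real.cos θ)) 0 =
      ∫ θ in (0 : ℝ)..Real.arccos c, (0 : ℝ) := by
    apply intervalIntegral.integral_congr
    intro θ hθ
    rw [Set.uIcc_of_le hβ0] at hθ
    refine max_eq_right (cosDefect_nonpos_of_hiCos_le (hy.trans (cosOfCot_mono ?_)))
    rw [← hRc, ← Real.cos_arccos (x := c) (by linarith) hc1.le]
    exact mul_le_mul_of_nonneg_left (Real.cos_le_cos_of_nonneg_of_le_pi hθ.1
        (Real.arccos_le_pi c) hθ.2) hR0.le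
  rw [e1, intervalIntegral.integral_zero, zero_add]
  have hc2 : c ^ 2 < 1 := by nlinarith
  have hb : ∀ ω : ℝ, (c * Real.cos ω) ^ 2 < 1 := fun ω => by
    rw [mul_pow]
    exact (mul_le_of_le_one_right (sq_nonneg c) (Real.cos_sq_le_one ω)).trans_lt hc2
  have hd : ∀ ω : ℝ, HasDerivAt (fun ω => Real.arccos (c * Real.cos ω))
      (c * Real.sin ω / √(1 - (c * Real.cos ω) ^ 2)) ω := by
    intro ω
    have h := abs_lt.1 ((sq_lt_one_iff_abs_lt_one _).1 (hb ω))
    refine ((Real.hasDerivAt_arccos h.1.ne' h.2.ne).comp ω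
      ((Real.hasDerivAt_cos ω).const_mul c)).congr_deriv ?_
    ring
  have hcd : Continuous fun ω => c * Real.sin ω / √(1 - (c * Real.cos ω) ^ 2) :=
    Continuous.div (by fun_prop) (by fun_prop) fun ω =>
      (Real.sqrt_pos.2 (by linarith [hb ω])).ne'
  have hsub := intervalIntegral.integral_comp_mul_deriv (a := 0) (b := Real.pi / 2)
    (g := fun θ => max (cosDefect (R * Real.cos θ)) 0) (fun ω _ => hd ω) hcd.continuousOn
    (by fun_prop)
  simp only [Real.cos_zero, Real.cos_pi_div_two, mul_one, mul_zero, Real.arccos_zero] at hsub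
  rw [← hsub]
  refine intervalIntegral.integral_mono_on (by positivity) ?_ ?_ ?_
  · exact (Continuous.mul (by fun_prop) hcd).intervalIntegrable _ _
  · exact (by fun_prop : Continuous fun θ =>
      max (cosDefect (K * Real.cos θ)) 0).intervalIntegrable _ _
  · intro ω hω
    have h := abs_lt.1 ((sq_lt_one_iff_abs_lt_one _).1 (hb ω))
    simp only [Function.comp]
    rw [Real.cos_arccos h.1.le h.2.le, ← mul_assoc, hRc]
    refine mul_le_of_le_one_right (le_max_right _ _) ?_
    rw [div_le_one (Real.sqrt_pos.2 (by linarith [hb ω]))]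
    apply Real.le_sqrt_of_sq_le
    have := Real.sin_sq_add_cos_sq ω
    calc (c * Real.sin ω) ^ 2 = c ^ 2 - (c * Real.cos ω) ^ 2 := by linear_combination c ^ 2 * this
      _ ≤ 1 - (c * Real.cos ω) ^ 2 := by linarith

theorem integral_posPart_cosDefect_le {R : ℝ} (hR : 0 ≤ R) :
    ∫ θ in (0 : ℝ)..Real.pi / 2, max (cosDefect (R * Real.cos θ)) 0 ≤ halfEdge := by
  rcases le_total R (√2)⁻¹ with h | h
  · have : ∫ θ in (0 : ℝ)..Real.pi / 2, max (cosDefect (R * Real.cos θ)) 0 =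
        ∫ θ in (0 : ℝ)..Real.pi / 2, (0 : ℝ) := by
      apply intervalIntegral.integral_congr
      intro θ _
      exact max_eq_right (cosDefect_nonpos_of_le
        ((mul_le_of_le_one_right hR (Real.cos_le_one θ)).trans h))
    rw [this, intervalIntegral.integral_zero]
    exact halfEdge_nonneg
  rcases le_or_gt (cosOfCot R) hiCos with hy | hy
  · exact integral_posPart_cosDefect_le_of_le h hy
  have hhi := loCos_pos.trans_le loCos_le_hiCos
  have h1 : hiCos < 1 := hy.trans (cosOfCot_lt_one R)
  obtain ⟨K, hK, hKeq⟩ : ∃ K ∈ Set.Icc (√2)⁻¹ R, cosOfCot K = hiCos :=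
    intermediate_value_Icc h continuous_cosOfCot.continuousOn
      ⟨cosOfCot_inv_sqrt_two.le.trans loCos_le_hiCos, hy.le⟩
  have hKR : K < R := hK.2.lt_of_ne (by rintro rfl; exact hy.ne' hKeq)
  have hK0 : 0 < K := lt_of_lt_of_le (by positivity) hK.1
  exact (integral_posPart_cosDefect_le_rescale hK0 hKR hKeq.ge).trans
    (integral_posPart_cosDefect_le_of_le hK.1 hKeq.le)

theorem setIntegral_cosDefect_le {R : ℝ} (hR : 0 ≤ R) {A : Set ℝ} (hA : MeasurableSet A) :
    ∫ θ in Set.Ioo (-Real.pi) Real.pi, A.indicator (fun θ => cosDefect (R * Real.cos θ)) θ ≤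
      2 * halfEdge := by
  have hc := continuous_cosDefect
  have hcont : Continuous fun θ => max (cosDefect (R * Real.cos θ)) 0 := by fun_prop
  have hcont' : Continuous fun θ => cosDefect (R * Real.cos θ) := by fun_prop
  have hi := fun a b => hcont.intervalIntegrable (μ := volume) a b
  have hpi := Real.pi_pos
  have hneg : ∀ a b, a ≤ b → (∀ θ ∈ Set.Icc a b, Real.cos θ ≤ 0) →
      ∫ θ in a..b, max (cosDefect (R * Real.cos θ)) 0 = 0 := by
    intro a b hab h
    rw [intervalIntegral.integral_congr (g := fun _ => (0 : ℝ)), intervalIntegral.integral_zero]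
    intro θ hθ
    rw [Set.uIcc_of_le hab] at hθ
    exact max_eq_right (cosDefect_nonpos_of_le
        ((mul_nonpos_of_nonneg_of_nonpos hR (h θ hθ)).trans (by positivity)))
  calc _ ≤ ∫ θ in Set.Ioo (-Real.pi) Real.pi, max (cosDefect (R * Real.cos θ)) 0 := by
        refine setIntegral_mono ?_ ?_ fun θ => ?_
        · exact ((hcont'.integrableOn_Icc).mono_set Set.Ioo_subset_Icc_self).indicator hA
        · exact (hcont.integrableOn_Icc).mono_set Set.Ioo_subset_Icc_self
        · by_cases h : θ ∈ A <;> simp [h]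
    _ = ∫ θ in (-Real.pi)..Real.pi, max (cosDefect (R * Real.cos θ)) 0 := by
        rw [intervalIntegral.integral_of_le (by linarith), integral_Ioc_eq_integral_Ioo]
    _ = 2 * ∫ θ in (0 : ℝ)..Real.pi / 2, max (cosDefect (R * Real.cos θ)) 0 := by
        rw [← intervalIntegral.integral_add_adjacent_intervals (hi (-Real.pi) 0) (hi _ _)]
        have : ∫ θ in (-Real.pi)..0, max (cosDefect (R * Real.cos θ)) 0 =
            ∫ θ in (0 : ℝ)..Real.pi, max (cosDefect (R * Real.cos θ)) 0 := by
          have := intervalIntegral.integral_comp_neg (a := -Real.pi) (b := 0)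
            (fun θ => max (cosDefect (R * Real.cos θ)) 0)
          simpa using this
        rw [this, ← intervalIntegral.integral_add_adjacent_intervals (hi 0 (Real.pi / 2)) (hi _ _),
          hneg (Real.pi / 2) Real.pi (by linarith) fun θ hθ =>
            Real.cos_nonpos_of_pi_div_two_le_of_le hθ.1 (by linarith [hθ.2])]
        ring
    _ ≤ 2 * halfEdge := by linarith [integral_posPart_cosDefect_le hR]

/-- The upper tail of the standard Gaussian distribution. -/
def gaussianTail (a : ℝ) : ℝ := 1 / 2 - ∫ z in (0 : ℝ)..a, gaussianPDFReal 0 1 z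

theorem gaussianPDFReal_zero_one (z : ℝ) :
    gaussianPDFReal 0 1 z = (√(2 * Real.pi))⁻¹ * Real.exp (-z ^ 2 / 2) := by
  simp [gaussianPDFReal]

theorem continuous_gaussianPDFReal_zero_one : Continuous (gaussianPDFReal 0 1) := by
  rw [funext gaussianPDFReal_zero_one]
  fun_prop

theorem integral_gaussianReal_zero_one (f : ℝ → ℝ) :
    ∫ z, f z ∂(gaussianReal 0 1) = ∫ z, gaussianPDFReal 0 1 z * f z := by
  rw [integral_gaussianReal_eq_integral_smul one_ne_zero]
  rfl

theorem setIntegral_Ici_gaussianPDFReal (a : ℝ) :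
    ∫ z in Set.Ici a, gaussianPDFReal 0 1 z = gaussianTail a := by
  have hint : Integrable (gaussianPDFReal 0 1) := integrable_gaussianPDFReal 0 1
  have hsym : ∫ z in Set.Ioi (0 : ℝ), gaussianPDFReal 0 1 z = 1 / 2 := by
    have h1 := intervalIntegral.integral_Iic_add_Ioi (b := 0) (μ := volume)
      hint.integrableOn hint.integrableOn
    rw [integral_gaussianPDFReal_eq_one 0 one_ne_zero] at h1
    have h2 := integral_comp_neg_Iic (0 : ℝ) (gaussianPDFReal 0 1)
    have h3 : ∀ x, gaussianPDFReal 0 1 (-x) = gaussianPDFReal 0 1 x := by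
      simp [gaussianPDFReal_zero_one]
    simp only [h3, neg_zero] at h2
    linarith
  rw [integral_Ici_eq_integral_Ioi, gaussianTail, ← hsym]
  have := intervalIntegral.integral_Ioi_sub_Ioi' (a := 0) (b := a) (μ := volume)
    (f := gaussianPDFReal 0 1) hint.integrableOn hint.integrableOn
  linarith

theorem hasDerivAt_gaussianTail (a : ℝ) : HasDerivAt gaussianTail (-gaussianPDFReal 0 1 a) a :=
  (continuous_gaussianPDFReal_zero_one.integral_hasStrictDerivAt 0 a).hasDerivAt.const_sub _

theorem continuous_gaussianTail : Continuous gaussianTail :=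
  continuous_iff_continuousAt.2 fun a => (hasDerivAt_gaussianTail a).continuousAt

theorem gaussianTail_nonneg (a : ℝ) : 0 ≤ gaussianTail a := by
  rw [← setIntegral_Ici_gaussianPDFReal]
  exact integral_nonneg fun z => gaussianPDFReal_nonneg 0 1 z

theorem gaussianTail_le_one (a : ℝ) : gaussianTail a ≤ 1 := by
  rw [← setIntegral_Ici_gaussianPDFReal, ← integral_gaussianPDFReal_eq_one 0 one_ne_zero]
  exact setIntegral_le_integral (integrable_gaussianPDFReal 0 1)
    (Filter.Eventually.of_forall fun z => gaussianPDFReal_nonneg 0 1 z)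

theorem integral_Ioi_mul_exp {b : ℝ} (hb : 0 < b) :
    IntegrableOn (fun r => r * Real.exp (-b * r ^ 2 / 2)) (Set.Ioi 0) ∧
    ∫ r in Set.Ioi (0 : ℝ), r * Real.exp (-b * r ^ 2 / 2) = 1 / b := by
  have hi : IntegrableOn (fun r => r * Real.exp (-b * r ^ 2 / 2)) (Set.Ioi 0) := by
    have := (integrable_mul_exp_neg_mul_sq (half_pos hb)).integrableOn (s := Set.Ioi 0)
    refine this.congr_fun (fun r _ => ?_) measurableSet_Ioi
    simp only; ring_nf
  refine ⟨hi, ?_⟩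
  have hd : ∀ r ∈ Set.Ici (0 : ℝ), HasDerivAt (fun r => -(1 / b) * Real.exp (-b * r ^ 2 / 2))
      (r * Real.exp (-b * r ^ 2 / 2)) r := by
    intro r _
    refine ((((hasDerivAt_pow 2 r).const_mul (-b)).div_const 2).exp.const_mul
      (-(1 / b))).congr_deriv ?_
    field_simp
    simp
    ring
  have ht : Filter.Tendsto (fun r => -(1 / b) * Real.exp (-b * r ^ 2 / 2)) Filter.atTop
      (nhds (-(1 / b) * 0)) := by
    refine (Real.tendsto_exp_atBot.comp ?_).const_mul _
    have := (Filter.tendsto_pow_atTop (α := ℝ) two_ne_zero).const_mul_atTop_of_neg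
      (show -b / 2 < 0 by linarith)
    refine this.congr fun r => by ring
  rw [integral_Ioi_of_hasDerivAt_of_tendsto' hd hi ht]
  simp

theorem setIntegral_Ici_mul_gaussianPDFReal (a : ℝ) :
    √(2 * Real.pi) * ∫ z in Set.Ici a, gaussianPDFReal 0 1 z * z = Real.exp (-a ^ 2 / 2) := by
  have hi : Integrable (fun z => z * Real.exp (-1 * z ^ 2 / 2)) := by
    have := (integrable_mul_exp_neg_mul_sq (half_pos one_pos))
    refine this.congr (Filter.Eventually.of_forall fun r => ?_)
    simp only; ring_nf
  have hd : ∀ r ∈ Set.Ici a, HasDerivAt (fun r => -Real.exp (-1 * r ^ 2 / 2))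
      (r * Real.exp (-1 * r ^ 2 / 2)) r := by
    intro r _
    refine (((hasDerivAt_pow 2 r).const_mul (-1)).div_const 2).exp.neg.congr_deriv ?_
    simp
    ring
  have ht : Filter.Tendsto (fun r : ℝ => -Real.exp (-1 * r ^ 2 / 2)) Filter.atTop
      (nhds (-0)) := by
    refine (Real.tendsto_exp_atBot.comp ?_).neg
    have := (Filter.tendsto_pow_atTop (α := ℝ) two_ne_zero).const_mul_atTop_of_neg
      (show (-1 : ℝ) / 2 < 0 by norm_num)
    refine this.congr fun r => by ring
  have key := integral_Ioi_of_hasDerivAt_of_tendsto' hd hi.integrableOn ht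
  rw [integral_Ici_eq_integral_Ioi, ← integral_const_mul]
  have hp : √(2 * Real.pi) ≠ 0 := by positivity
  have : ∀ z, √(2 * Real.pi) * (gaussianPDFReal 0 1 z * z) = z * Real.exp (-1 * z ^ 2 / 2) := by
    intro z; rw [gaussianPDFReal_zero_one]; field_simp
  simp_rw [this, key]
  norm_num

theorem integral_Ioi_mul_exp_mul_gaussianTail (k : ℝ) :
    IntegrableOn (fun r => r * Real.exp (-r ^ 2 / 2) * gaussianTail (k * r)) (Set.Ioi 0) ∧
    ∫ r in Set.Ioi (0 : ℝ), r * Real.exp (-r ^ 2 / 2) * gaussianTail (k * r) =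
      (1 - cosOfCot k) / 2 := by
  have hT := continuous_gaussianTail
  have hexp : IntegrableOn (fun r => r * Real.exp (-r ^ 2 / 2)) (Set.Ioi 0) := by
    simpa using (integral_Ioi_mul_exp one_pos).1
  have hi : IntegrableOn (fun r => r * Real.exp (-r ^ 2 / 2) * gaussianTail (k * r))
      (Set.Ioi 0) := by
    refine hexp.mul_bdd (c := 1) (by fun_prop) (Filter.Eventually.of_forall fun r => ?_)
    rw [Real.norm_of_nonneg (gaussianTail_nonneg _)]
    exact gaussianTail_le_one _
  refine ⟨hi, ?_⟩
  have hb : 0 < (1 + k ^ 2) / 2 := by positivity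
  have e2 : ∀ r, Real.exp (-r ^ 2 / 2) * (k * gaussianPDFReal 0 1 (k * r)) =
      k * (√(2 * Real.pi))⁻¹ * Real.exp (-((1 + k ^ 2) / 2) * r ^ 2) := by
    intro r
    rw [gaussianPDFReal_zero_one, show -((1 + k ^ 2) / 2) * r ^ 2 = -r ^ 2 / 2 + -(k * r) ^ 2 / 2 by
      ring, Real.exp_add]
    ring
  have hi2 : IntegrableOn (fun r => Real.exp (-r ^ 2 / 2) * (k * gaussianPDFReal 0 1 (k * r)))
      (Set.Ioi 0) := by
    simp_rw [e2]
    exact ((integrable_exp_neg_mul_sq hb).const_mul _).integrableOn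
  have hd : ∀ r ∈ Set.Ici (0 : ℝ),
      HasDerivAt (fun r => -(Real.exp (-r ^ 2 / 2) * gaussianTail (k * r)))
      (r * Real.exp (-r ^ 2 / 2) * gaussianTail (k * r) +
        Real.exp (-r ^ 2 / 2) * (k * gaussianPDFReal 0 1 (k * r))) r := by
    intro r _
    have h1 := ((hasDerivAt_pow 2 r).neg.div_const 2).exp
    have h2 := (hasDerivAt_gaussianTail (k * r)).comp r ((hasDerivAt_id r).const_mul k)
    refine (h1.mul h2).neg.congr_deriv ?_
    simp
    ring
  have ht : Filter.Tendsto (fun r => -(Real.exp (-r ^ 2 / 2) * gaussianTail (k * r))) Filter.atTop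
      (nhds (-0)) := by
    refine Filter.Tendsto.neg ?_
    refine squeeze_zero (fun r => mul_nonneg (Real.exp_pos _).le (gaussianTail_nonneg _))
      (fun r => mul_le_of_le_one_right (Real.exp_pos _).le (gaussianTail_le_one _)) ?_
    refine Real.tendsto_exp_atBot.comp ?_
    have := (Filter.tendsto_pow_atTop (α := ℝ) two_ne_zero).const_mul_atTop_of_neg
      (show (-1 : ℝ) / 2 < 0 by norm_num)
    refine this.congr fun r => by ring
  have key := integral_Ioi_of_hasDerivAt_of_tendsto' hd (hi.add hi2) ht
  have hpi := Real.pi_pos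
  rw [integral_add hi hi2] at key
  simp_rw [e2] at key
  rw [integral_const_mul, integral_gaussian_Ioi] at key
  have hs : √(Real.pi / ((1 + k ^ 2) / 2)) = √(2 * Real.pi) / √(1 + k ^ 2) := by
    rw [← Real.sqrt_div (by positivity)]; congr 1; field_simp
  rw [hs] at key
  have h0 : gaussianTail 0 = 1 / 2 := by simp [gaussianTail]
  have hp : √(2 * Real.pi) ≠ 0 := by positivity
  have hy : k * (√(2 * Real.pi))⁻¹ * (√(2 * Real.pi) / √(1 + k ^ 2) / 2) = cosOfCot k / 2 := by
    rw [cosOfCot]; field_simp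
  rw [hy] at key
  simp [h0] at key
  linarith

/-- The weight charged per radian in the tilted Gaussian mean width. -/
def arcCharge : ℝ := (1 - loCos) * (1 - hiCos)

/-- The tilted integrand, integrated over the axial coordinate. -/
def axialValue (a : ℝ) : ℝ :=
  Real.exp (-a ^ 2 / 2) - 2 * (hiCos + loCos) * gaussianTail a - arcCharge

theorem continuous_axialValue : Continuous axialValue := by
  have := continuous_gaussianTail
  unfold axialValue
  fun_prop

theorem norm_axialValue_le (a : ℝ) : ‖axialValue a‖ ≤ 1 + 2 * |hiCos + loCos| + |arcCharge| := by
  have h1 : |Real.exp (-a ^ 2 / 2)| ≤ 1 := by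
    rw [abs_of_pos (Real.exp_pos _), Real.exp_le_one_iff]
    nlinarith [sq_nonneg a]
  have h2 : |2 * (hiCos + loCos) * gaussianTail a| ≤ 2 * |hiCos + loCos| := by
    rw [abs_mul, abs_mul, abs_two, abs_of_nonneg (gaussianTail_nonneg a)]
    exact mul_le_of_le_one_right (by positivity) (gaussianTail_le_one a)
  rw [axialValue, Real.norm_eq_abs]
  exact (abs_sub _ _).trans (add_le_add ((abs_sub _ _).trans (add_le_add h1 h2)) le_rfl)

theorem integral_radial_axialValue (k : ℝ) :
    ∫ r in Set.Ioi (0 : ℝ), r * Real.exp (-r ^ 2 / 2) * axialValue (k * r) = cosDefect k := by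
  have h1 := integral_Ioi_mul_exp one_pos
  have h2 := integral_Ioi_mul_exp (b := 1 + k ^ 2) (by positivity)
  have h3 := integral_Ioi_mul_exp_mul_gaussianTail k
  simp only [neg_mul, one_mul, ne_eq, one_ne_zero, not_false_eq_true, div_self] at h1
  have e : ∀ r, r * Real.exp (-r ^ 2 / 2) * axialValue (k * r) =
      r * Real.exp (-(1 + k ^ 2) * r ^ 2 / 2)
        - 2 * (hiCos + loCos) * (r * Real.exp (-r ^ 2 / 2) * gaussianTail (k * r))
        - arcCharge * (r * Real.exp (-r ^ 2 / 2)) := by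
    intro r
    rw [show -(1 + k ^ 2) * r ^ 2 / 2 = -r ^ 2 / 2 + -(k * r) ^ 2 / 2 by ring, Real.exp_add,
      axialValue]
    ring
  simp_rw [e]
  have h4 : IntegrableOn (fun r => r * Real.exp (-(1 + k ^ 2) * r ^ 2 / 2)
      - 2 * (hiCos + loCos) * (r * Real.exp (-r ^ 2 / 2) * gaussianTail (k * r))) (Set.Ioi 0) :=
    h2.1.sub (h3.1.const_mul _)
  rw [integral_sub h4 (h1.1.const_mul _),
    integral_sub h2.1 (h3.1.const_mul _), integral_const_mul, integral_const_mul, h1.2, h2.2, h3.2]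
  have := cosOfCot_sq k
  rw [cosDefect, arcCharge]
  linear_combination this

theorem integral_gaussianReal_prod {H : ℝ × ℝ → ℝ} (hH : Measurable H) {M : ℝ}
    (hM : ∀ w, ‖H w‖ ≤ M) :
    ∫ w, H w ∂((gaussianReal 0 1).prod (gaussianReal 0 1)) =
      ∫ w : ℝ × ℝ, gaussianPDFReal 0 1 w.1 * gaussianPDFReal 0 1 w.2 * H w := by
  have hp : Integrable (gaussianPDFReal 0 1) := integrable_gaussianPDFReal 0 1
  have h1 : Integrable H ((gaussianReal 0 1).prod (gaussianReal 0 1)) :=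
    Integrable.of_bound hH.aestronglyMeasurable M (Filter.Eventually.of_forall hM)
  have h2 : Integrable (fun w : ℝ × ℝ => gaussianPDFReal 0 1 w.1 * gaussianPDFReal 0 1 w.2 * H w) :=
    (hp.mul_prod hp).mul_bdd hH.aestronglyMeasurable (Filter.Eventually.of_forall hM)
  rw [integral_prod _ h1, integral_gaussianReal_zero_one, Measure.volume_eq_prod,
    integral_prod _ h2]
  refine integral_congr_ae (Filter.Eventually.of_forall fun x => ?_)
  simp only [integral_gaussianReal_zero_one, ← integral_const_mul, mul_assoc]

theorem integral_gaussianReal_prod_polar {H : ℝ × ℝ → ℝ} (hH : Measurable H) {M : ℝ}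
    (hM : ∀ w, ‖H w‖ ≤ M) :
    ∫ w, H w ∂((gaussianReal 0 1).prod (gaussianReal 0 1)) =
      (2 * Real.pi)⁻¹ * ∫ θ in Set.Ioo (-Real.pi) Real.pi, ∫ r in Set.Ioi (0 : ℝ),
        r * Real.exp (-r ^ 2 / 2) * H (r * Real.cos θ, r * Real.sin θ) := by
  have hexp : IntegrableOn (fun r => r * Real.exp (-r ^ 2 / 2)) (Set.Ioi 0) := by
    simpa using (integral_Ioi_mul_exp one_pos).1
  have hone : IntegrableOn (fun _ : ℝ => (1 : ℝ)) (Set.Ioo (-Real.pi) Real.pi) :=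
    integrableOn_const (by simp)
  have hint : Integrable (fun p : ℝ × ℝ => p.1 * Real.exp (-p.1 ^ 2 / 2) *
      H (p.1 * Real.cos p.2, p.1 * Real.sin p.2))
      ((volume.restrict (Set.Ioi 0)).prod (volume.restrict (Set.Ioo (-Real.pi) Real.pi))) := by
    have := (hexp.mul_prod hone)
    simp only [mul_one] at this
    refine this.mul_bdd (c := M) ?_ (Filter.Eventually.of_forall fun w => hM _)
    exact (hH.comp (by fun_prop)).aestronglyMeasurable
  rw [integral_gaussianReal_prod hH hM, ← integral_comp_polarCoord_symm, polarCoord_target,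
    ← integral_prod_symm _ hint, Measure.prod_restrict, ← Measure.volume_eq_prod,
    ← integral_const_mul]
  refine integral_congr_ae (Filter.Eventually.of_forall fun p => ?_)
  have hpi := Real.pi_pos
  have h3 : (2 * Real.pi)⁻¹ = (√(2 * Real.pi))⁻¹ ^ 2 := by
    rw [inv_pow, Real.sq_sqrt (by positivity)]
  have h4 : Real.exp (-p.1 ^ 2 / 2) = Real.exp (-(p.1 * Real.cos p.2) ^ 2 / 2) *
      Real.exp (-(p.1 * Real.sin p.2) ^ 2 / 2) := by
    rw [← Real.exp_add]; congr 1
    linear_combination (p.1 ^ 2 / 2) * (Real.sin_sq_add_cos_sq p.2)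
  simp only [polarCoord_symm_apply, gaussianPDFReal_zero_one, smul_eq_mul]
  rw [h4, h3]
  ring

/-- The gain of the tilted Gaussian maximum over the cone `C` next to the first axis. -/
def coneGain (R : ℝ) (C : Set (ℝ × ℝ)) (x : ℝ × ℝ × ℝ) : ℝ :=
  C.indicator (fun w => (Set.Ici (R * w.1)).indicator
    (fun z => √(2 * Real.pi) * z - 2 * (hiCos + loCos)) x.1 - arcCharge) x.2

theorem measurable_coneGain (R : ℝ) {C : Set (ℝ × ℝ)} (hC : MeasurableSet C) :
    Measurable (coneGain R C) := by
  have h1 : MeasurableSet {x : ℝ × ℝ × ℝ | R * x.2.1 ≤ x.1} :=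
    measurableSet_le (by fun_prop) (by fun_prop)
  have h2 : MeasurableSet {x : ℝ × ℝ × ℝ | x.2 ∈ C} := measurable_snd hC
  have : coneGain R C = {x : ℝ × ℝ × ℝ | x.2 ∈ C}.indicator (fun x =>
      {x : ℝ × ℝ × ℝ | R * x.2.1 ≤ x.1}.indicator
        (fun x => √(2 * Real.pi) * x.1 - 2 * (hiCos + loCos)) x - arcCharge) := by
    funext x
    simp [coneGain, Set.indicator]
  rw [this]
  refine Measurable.indicator (Measurable.sub (Measurable.indicator ?_ h1) measurable_const) h2
  fun_prop

theorem integrable_coneGain (R : ℝ) {C : Set (ℝ × ℝ)} (hC : MeasurableSet C) :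
    Integrable (coneGain R C)
      ((gaussianReal 0 1).prod ((gaussianReal 0 1).prod (gaussianReal 0 1))) := by
  have hz : Integrable (fun z : ℝ => z) (gaussianReal 0 1) :=
    memLp_one_iff_integrable.1 (memLp_id_gaussianReal 1)
  have hz' : Integrable (fun x : ℝ × ℝ × ℝ => x.1)
      ((gaussianReal 0 1).prod ((gaussianReal 0 1).prod (gaussianReal 0 1))) := hz.comp_fst _
  refine ((hz'.norm.const_mul √(2 * Real.pi)).add
    (integrable_const (|2 * (hiCos + loCos)| + |arcCharge|))).mono'
    (measurable_coneGain R hC).aestronglyMeasurable (Filter.Eventually.of_forall fun x => ?_)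
  have hs : ‖√(2 * Real.pi) * x.1‖ = √(2 * Real.pi) * ‖x.1‖ := by
    rw [norm_mul, Real.norm_of_nonneg (Real.sqrt_nonneg _)]
  refine (norm_indicator_le_norm_self _ _).trans ((norm_sub_le _ _).trans ?_)
  refine (add_le_add ((norm_indicator_le_norm_self (fun z => √(2 * Real.pi) * z
    - 2 * (hiCos + loCos)) x.1).trans (norm_sub_le _ _)) le_rfl).trans ?_
  simp only [Pi.add_apply, hs, Real.norm_eq_abs, add_assoc, le_refl]

theorem integral_coneGain_axial (R : ℝ) (C : Set (ℝ × ℝ)) (w : ℝ × ℝ) :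
    ∫ z, coneGain R C (z, w) ∂(gaussianReal 0 1) =
      C.indicator (fun w => axialValue (R * w.1)) w := by
  by_cases hw : w ∈ C
  · have hz : Integrable (fun z : ℝ => z) (gaussianReal 0 1) :=
      memLp_one_iff_integrable.1 (memLp_id_gaussianReal 1)
    have hi : Integrable (fun z : ℝ => √(2 * Real.pi) * z - 2 * (hiCos + loCos))
      (gaussianReal 0 1) := (hz.const_mul _).sub (integrable_const _)
    simp only [coneGain, Set.indicator_of_mem hw]
    rw [integral_sub (hi.indicator measurableSet_Ici) (integrable_const _), integral_const,
      integral_gaussianReal_zero_one]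
    have hp : Integrable (gaussianPDFReal 0 1) := integrable_gaussianPDFReal 0 1
    have hzp : Integrable (fun z => gaussianPDFReal 0 1 z * z) := by
      have := (integrable_mul_exp_neg_mul_sq (half_pos one_pos)).const_mul (√(2 * Real.pi))⁻¹
      refine this.congr (Filter.Eventually.of_forall fun r => ?_)
      simp only [gaussianPDFReal_zero_one]; ring_nf
    have e : ∀ z, gaussianPDFReal 0 1 z * (Set.Ici (R * w.1)).indicator
        (fun z => √(2 * Real.pi) * z - 2 * (hiCos + loCos)) z =
        (Set.Ici (R * w.1)).indicator (fun z => √(2 * Real.pi) * (gaussianPDFReal 0 1 z * z)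
          - 2 * (hiCos + loCos) * gaussianPDFReal 0 1 z) z := by
      intro z
      by_cases hz : z ∈ Set.Ici (R * w.1)
      · simp only [Set.indicator_of_mem hz]; ring
      · simp only [Set.indicator_of_notMem hz, mul_zero]
    simp_rw [e]
    rw [integral_indicator measurableSet_Ici, integral_sub (hzp.const_mul _).integrableOn
      (hp.const_mul _).integrableOn, integral_const_mul, integral_const_mul,
      setIntegral_Ici_gaussianPDFReal, setIntegral_Ici_mul_gaussianPDFReal]
    simp [axialValue]
  · simp [coneGain, Set.indicator_of_notMem hw]

/-- Integrating the gain over a cone leaves an integral over the directions of the cone. -/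
theorem integral_coneGain (R : ℝ) {C : Set (ℝ × ℝ)} (hC : MeasurableSet C)
    (hcone : ∀ t : ℝ, 0 < t → ∀ x y, (t * x, t * y) ∈ C ↔ (x, y) ∈ C) :
    ∫ x, coneGain R C x ∂((gaussianReal 0 1).prod ((gaussianReal 0 1).prod (gaussianReal 0 1))) =
      (2 * Real.pi)⁻¹ * ∫ θ in Set.Ioo (-Real.pi) Real.pi,
        {θ | (Real.cos θ, Real.sin θ) ∈ C}.indicator (fun θ => cosDefect (R * Real.cos θ)) θ := by
  have hcont := continuous_axialValue
  rw [integral_prod_symm _ (integrable_coneGain R hC)]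
  simp_rw [integral_coneGain_axial]
  rw [integral_gaussianReal_prod_polar (M := 1 + 2 * |hiCos + loCos| + |arcCharge|)
    (Measurable.indicator (Continuous.measurable (by fun_prop)) hC)
    (fun w => (norm_indicator_le_norm_self _ _).trans (norm_axialValue_le _))]
  congr 1
  refine integral_congr_ae (Filter.Eventually.of_forall fun θ => ?_)
  by_cases hθ : (Real.cos θ, Real.sin θ) ∈ C
  · have hθ' : θ ∈ {θ | (Real.cos θ, Real.sin θ) ∈ C} := hθ
    simp only [Set.indicator_of_mem hθ', ← integral_radial_axialValue]
    refine setIntegral_congr_fun measurableSet_Ioi fun r hr => ?_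
    have := (hcone r hr _ _).2 hθ
    simp only [Set.indicator_of_mem this]
    ring_nf
  · have hθ' : θ ∉ {θ | (Real.cos θ, Real.sin θ) ∈ C} := hθ
    simp only [Set.indicator_of_notMem hθ']
    refine (setIntegral_congr_fun (g := fun _ => 0) measurableSet_Ioi fun r hr => ?_).trans
      (by simp)
    have := (hcone r hr _ _).not.2 hθ
    simp only [Set.indicator_of_notMem this, mul_zero]

theorem integral_coneGain_le {R : ℝ} (hR : 0 ≤ R) {C : Set (ℝ × ℝ)} (hC : MeasurableSet C)
    (hcone : ∀ t : ℝ, 0 < t → ∀ x y, (t * x, t * y) ∈ C ↔ (x, y) ∈ C) :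
    ∫ x, coneGain R C x ∂((gaussianReal 0 1).prod ((gaussianReal 0 1).prod (gaussianReal 0 1))) ≤
      halfEdge / Real.pi := by
  rw [integral_coneGain R hC hcone]
  have hA : MeasurableSet {θ : ℝ | (Real.cos θ, Real.sin θ) ∈ C} :=
    (show Measurable fun θ : ℝ => (Real.cos θ, Real.sin θ) by fun_prop) hC
  have := setIntegral_cosDefect_le hR hA
  have hpi := Real.pi_pos
  calc _ ≤ (2 * Real.pi)⁻¹ * (2 * halfEdge) := by gcongr
    _ = _ := by field_simp

theorem map_pi_gaussianReal_dotProduct {ι : Type*} [Fintype ι] [DecidableEq ι] {v : ι → ι → ℝ}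
    (hv : ∀ i j, v i ⬝ᵥ v j = if i = j then 1 else 0) :
    (Measure.pi fun _ : ι => gaussianReal 0 1).map (fun x i => x ⬝ᵥ v i) =
      Measure.pi fun _ : ι => gaussianReal 0 1 := by
  have hon : Orthonormal ℝ (fun i => (WithLp.toLp 2 (v i) : EuclideanSpace ℝ ι)) := by
    rw [orthonormal_iff_ite]
    intro i j
    rw [EuclideanSpace.inner_toLp_toLp]
    simp [dotProduct_comm, hv]
  let o : OrthonormalBasis ι ℝ (EuclideanSpace ℝ ι) :=
    OrthonormalBasis.mk hon (by
      rw [LinearIndependent.span_eq_top_of_card_eq_finrank' hon.linearIndependent (by simp)])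
  have h1 := (stdGaussian_eq_map_pi_orthonormalBasis o).symm.trans
    (map_pi_eq_stdGaussian (ι := ι)).symm
  have h2 := congrArg (Measure.map (fun (x : EuclideanSpace ℝ ι) i => inner ℝ (o i) x)) h1
  rw [Measure.map_map (by fun_prop) (by fun_prop), Measure.map_map (by fun_prop) (by fun_prop)]
    at h2
  have e1 : ((fun (x : EuclideanSpace ℝ ι) i => inner ℝ (o i) x) ∘
      fun x : ι → ℝ => ∑ i, x i • o i) = id := by
    funext x i
    simp [inner_sum, inner_smul_right, orthonormal_iff_ite.1 o.orthonormal]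
  have e2 : ((fun (x : EuclideanSpace ℝ ι) i => inner ℝ (o i) x) ∘
      WithLp.toLp 2) = fun x i => x ⬝ᵥ v i := by
    funext x i
    simp [o, EuclideanSpace.inner_toLp_toLp]
  rw [e1, e2, Measure.map_id] at h2
  exact h2.symm

theorem measurePreserving_gaussian_frame {v : Fin 3 → Fin 3 → ℝ}
    (hv : ∀ i j, v i ⬝ᵥ v j = if i = j then 1 else 0) :
    MeasurePreserving (fun x => (x ⬝ᵥ v 0, x ⬝ᵥ v 1, x ⬝ᵥ v 2))
      (Measure.pi fun _ : Fin 3 => gaussianReal 0 1)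
      ((gaussianReal 0 1).prod ((gaussianReal 0 1).prod (gaussianReal 0 1))) := by
  have h1 : MeasurePreserving (fun x i => x ⬝ᵥ v i) (Measure.pi fun _ : Fin 3 => gaussianReal 0 1)
      (Measure.pi fun _ : Fin 3 => gaussianReal 0 1) :=
    ⟨by unfold dotProduct; fun_prop, map_pi_gaussianReal_dotProduct hv⟩
  have h2 := measurePreserving_piFinSuccAbove (fun _ : Fin 3 => gaussianReal 0 1) 0
  have h3 := (MeasurePreserving.id (gaussianReal 0 1)).prod
    (measurePreserving_piFinTwo (fun _ : Fin 2 => gaussianReal 0 1))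
  exact (h3.comp h2).comp h1

/-- A unit vector and a vector orthogonal to it span the first two axes of some frame. -/
theorem exists_frame {r q : Fin 3 → ℝ} (hr : r ⬝ᵥ r = 1) (hq : r ⬝ᵥ q = 0) :
    ∃ (v : Fin 3 → Fin 3 → ℝ) (R : ℝ), (∀ i j, v i ⬝ᵥ v j = if i = j then 1 else 0) ∧
      v 0 = r ∧ 0 ≤ R ∧ q = R • v 1 := by
  suffices H : ∀ q : Fin 3 → ℝ, q ≠ 0 → r ⬝ᵥ q = 0 → ∃ (v : Fin 3 → Fin 3 → ℝ) (R : ℝ),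
      (∀ i j, v i ⬝ᵥ v j = if i = j then 1 else 0) ∧ v 0 = r ∧ 0 ≤ R ∧ q = R • v 1 by
    by_cases h0 : q = 0
    · obtain ⟨q', h1, h2⟩ := exists_ne_zero_dotProduct_eq_zero r
      obtain ⟨v, R, h3, h4, -, -⟩ := H q' h1 ((dotProduct_comm _ _).trans h2)
      exact ⟨v, 0, h3, h4, le_rfl, by simp [h0]⟩
    · exact H q h0 hq
  intro q h0 hq
  have hpos : 0 < q ⬝ᵥ q := by
    have := dotProduct_star_self_pos_iff.2 h0
    simpa using this
  set R := √(q ⬝ᵥ q) with hR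
  have hR0 : 0 < R := Real.sqrt_pos.2 hpos
  have hRR : R * R = q ⬝ᵥ q := Real.mul_self_sqrt hpos.le
  have h11 : (R⁻¹ • q) ⬝ᵥ (R⁻¹ • q) = 1 := by
    rw [smul_dotProduct, dotProduct_smul, smul_eq_mul, smul_eq_mul, ← hRR]; field_simp
  have h01 : r ⬝ᵥ (R⁻¹ • q) = 0 := by rw [dotProduct_smul, hq, smul_zero]
  have hqR : q = R • R⁻¹ • q := by simp [smul_smul, hR0.ne']
  generalize R⁻¹ • q = u at h11 h01 hqR
  refine ⟨![r, u, crossProduct r u], R, ?_, rfl, hR0.le, hqR⟩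
  have h22 := cross_dot_cross r u r u
  rw [hr, h11, h01, dotProduct_comm _ r, h01] at h22
  have h02 := dot_self_cross r u
  have h12 := dot_cross_self r u
  have h10 := (dotProduct_comm _ _).trans h01
  have h20 := (dotProduct_comm _ _).trans h02
  have h21 := (dotProduct_comm _ _).trans h12
  intro i j
  fin_cases i <;> fin_cases j <;> simp [hr, h11, h01, h22, h02, h12, h10, h20, h21]

theorem ae_dotProduct_ne_zero {v : Fin 3 → ℝ} (hv : v ≠ 0) :
    ∀ᵐ x ∂(Measure.pi fun _ : Fin 3 => gaussianReal 0 1), x ⬝ᵥ v ≠ 0 := by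
  obtain ⟨q, hq0, hq⟩ := exists_ne_zero_dotProduct_eq_zero v
  have hpos : 0 < v ⬝ᵥ v := by
    have := dotProduct_star_self_pos_iff.2 hv
    simpa using this
  have hR0 : 0 < √(v ⬝ᵥ v) := Real.sqrt_pos.2 hpos
  have hRR := Real.mul_self_sqrt hpos.le
  obtain ⟨w, -, hw, hw0, -, -⟩ := exists_frame (r := (√(v ⬝ᵥ v))⁻¹ • v) (q := q)
    (by rw [smul_dotProduct, dotProduct_smul, smul_eq_mul, smul_eq_mul]; nth_rw 3 [← hRR]
        field_simp) (by rw [smul_dotProduct, dotProduct_comm v q, hq, smul_zero])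
  have hnull : ∀ᵐ x ∂((gaussianReal 0 1).prod ((gaussianReal 0 1).prod (gaussianReal 0 1))),
      x.1 ≠ 0 := by
    have := nullSingletonClass_gaussianReal (μ := 0) one_ne_zero
    have : ∀ᵐ z ∂(gaussianReal 0 1), z ≠ 0 := by
      rw [ae_iff]; simp
    exact Measure.quasiMeasurePreserving_fst.ae this
  filter_upwards [(measurePreserving_gaussian_frame hw).quasiMeasurePreserving.ae hnull] with x hx h
  simp [hw0, h] at hx

theorem dotProduct_eq_sum_frame {v : Fin 3 → Fin 3 → ℝ}
    (hv : ∀ i j, v i ⬝ᵥ v j = if i = j then 1 else 0) (x y : Fin 3 → ℝ) :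
    x ⬝ᵥ y = ∑ k, (x ⬝ᵥ v k) * (y ⬝ᵥ v k) := by
  have h1 : (Matrix.of v) * (Matrix.of v)ᵀ = 1 := by
    ext i j
    rw [Matrix.one_apply, ← hv i j]
    rfl
  have h2 := mul_eq_one_comm.1 h1
  calc x ⬝ᵥ y = x ⬝ᵥ (((Matrix.of v)ᵀ * Matrix.of v) *ᵥ y) := by rw [h2, Matrix.one_mulVec]
    _ = (Matrix.of v *ᵥ x) ⬝ᵥ (Matrix.of v *ᵥ y) := by
      rw [← Matrix.mulVec_mulVec, Matrix.dotProduct_mulVec, Matrix.vecMul_transpose]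
    _ = _ := Finset.sum_congr rfl fun k _ => by
      simp only [Matrix.mulVec, Matrix.of_apply, dotProduct_comm]

theorem dotProduct_lt_one {a b : Fin 3 → ℝ} (ha : a ⬝ᵥ a = 1) (hb : b ⬝ᵥ b = 1) (h : a ≠ b) :
    a ⬝ᵥ b < 1 := by
  have h1 : 0 < (a - b) ⬝ᵥ (a - b) := by
    have := dotProduct_star_self_pos_iff.2 (sub_ne_zero.2 h)
    simpa using this
  rw [sub_dotProduct, dotProduct_sub, dotProduct_sub, dotProduct_comm b a, ha, hb] at h1
  linarith

/-- The vector orthogonal to `r i` such that `r i` beats `r j` at `x` exactly when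
it beats this vector. -/
def edgeVector {ι : Type*} (r : ι → Fin 3 → ℝ) (i j : ι) : Fin 3 → ℝ :=
  (1 - r i ⬝ᵥ r j)⁻¹ • (r j - (r i ⬝ᵥ r j) • r i)

/-- The gain of the tilted Gaussian maximum at `r i` in the sector facing `r j`. -/
def edgeGain {ι : Type*} (r : ι → Fin 3 → ℝ) (i j : ι) (x : Fin 3 → ℝ) : ℝ :=
  {x | i ≠ j ∧ ∀ l, i ≠ l → x ⬝ᵥ edgeVector r i l ≤ x ⬝ᵥ edgeVector r i j}.indicator
    (fun x => {x | x ⬝ᵥ edgeVector r i j ≤ x ⬝ᵥ r i}.indicator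
      (fun x => √(2 * Real.pi) * (x ⬝ᵥ r i) - 2 * (hiCos + loCos)) x - arcCharge) x

/-- Some plane supports the convex hull of the points `r` exactly along the segment
from `r i` to `r j`. -/
def IsStrictEdge {ι : Type*} (r : ι → Fin 3 → ℝ) (i j : ι) : Prop :=
  ∃ u, u ⬝ᵥ r i = u ⬝ᵥ r j ∧ ∀ l, l ≠ i → l ≠ j → u ⬝ᵥ r l < u ⬝ᵥ r i

theorem edgeGain_self {ι : Type*} (r : ι → Fin 3 → ℝ) (i : ι) (x : Fin 3 → ℝ) :
    edgeGain r i i x = 0 := by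
  simp [edgeGain]

theorem dotProduct_edgeVector {ι : Type*} {r : ι → Fin 3 → ℝ} (hr : ∀ i, r i ⬝ᵥ r i = 1)
    (i j : ι) : r i ⬝ᵥ edgeVector r i j = 0 := by
  simp [edgeVector, dotProduct_smul, dotProduct_sub, hr]

theorem dotProduct_eq_edgeVector_add {ι : Type*} {r : ι → Fin 3 → ℝ} {i j : ι}
    (h : r i ⬝ᵥ r j < 1) (x : Fin 3 → ℝ) :
    x ⬝ᵥ r j = (1 - r i ⬝ᵥ r j) * (x ⬝ᵥ edgeVector r i j) + (r i ⬝ᵥ r j) * (x ⬝ᵥ r i) := by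
  have : 1 - r i ⬝ᵥ r j ≠ 0 := by linarith
  simp only [edgeVector, dotProduct_smul, dotProduct_sub, smul_eq_mul]
  field_simp
  ring

theorem dotProduct_edgeVector_le_iff {ι : Type*} {r : ι → Fin 3 → ℝ} {i j : ι}
    (h : r i ⬝ᵥ r j < 1) (x : Fin 3 → ℝ) :
    x ⬝ᵥ edgeVector r i j ≤ x ⬝ᵥ r i ↔ x ⬝ᵥ r j ≤ x ⬝ᵥ r i := by
  rw [dotProduct_eq_edgeVector_add h x]
  constructor <;> intro h' <;> nlinarith

theorem edgeVector_injOn {ι : Type*} {r : ι → Fin 3 → ℝ} (hr : ∀ i, r i ⬝ᵥ r i = 1)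
    (hinj : Function.Injective r) {i j l : ι} (hj : i ≠ j) (hl : i ≠ l)
    (h : edgeVector r i j = edgeVector r i l) : j = l := by
  have hj1 := dotProduct_lt_one (hr i) (hr j) (hinj.ne hj)
  have hl1 := dotProduct_lt_one (hr i) (hr l) (hinj.ne hl)
  have norm_edge : ∀ m, r i ⬝ᵥ r m < 1 →
      (1 - r i ⬝ᵥ r m) * (edgeVector r i m ⬝ᵥ edgeVector r i m) = 1 + r i ⬝ᵥ r m := by
    intro m hm
    have h0 : 1 - r i ⬝ᵥ r m ≠ 0 := by linarith
    simp only [edgeVector, dotProduct_smul, smul_dotProduct, dotProduct_sub, sub_dotProduct,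
      smul_eq_mul, hr, dotProduct_comm (r m) (r i)]
    field_simp
    ring
  have e1 := norm_edge j hj1
  have e2 := norm_edge l hl1
  rw [h] at e1
  have hc : r i ⬝ᵥ r j = r i ⬝ᵥ r l := by
    have : (r i ⬝ᵥ r j - r i ⬝ᵥ r l) * (1 + edgeVector r i l ⬝ᵥ edgeVector r i l) = 0 := by
      linear_combination e2 - e1
    have h3 : 0 ≤ edgeVector r i l ⬝ᵥ edgeVector r i l := by
      simpa using dotProduct_star_self_nonneg (edgeVector r i l)
    rcases mul_eq_zero.1 this with h4 | h4 <;> linarith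
  refine hinj ?_
  have h0 : 1 - r i ⬝ᵥ r l ≠ 0 := by linarith
  rw [edgeVector, edgeVector, hc] at h
  exact sub_left_injective (smul_right_injective _ (inv_ne_zero h0) h)

/-- The sector of `edgeGain`, in the coordinates of a frame based at `r i`. -/
def edgeCone {ι : Type*} (r : ι → Fin 3 → ℝ) (i : ι) (v : Fin 3 → Fin 3 → ℝ) (R : ℝ) :
    Set (ℝ × ℝ) :=
  {w | ∀ l, i ≠ l → (edgeVector r i l ⬝ᵥ v 1) * w.1 + (edgeVector r i l ⬝ᵥ v 2) * w.2 ≤ R * w.1}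

theorem measurableSet_edgeCone {ι : Type*} [Finite ι] (r : ι → Fin 3 → ℝ) (i : ι)
    (v : Fin 3 → Fin 3 → ℝ) (R : ℝ) : MeasurableSet (edgeCone r i v R) := by
  simp only [edgeCone, Set.ofPred_forall]
  exact MeasurableSet.iInter fun l => MeasurableSet.iInter fun _ =>
    measurableSet_le (by fun_prop) (by fun_prop)

theorem smul_mem_edgeCone {ι : Type*} (r : ι → Fin 3 → ℝ) (i : ι)
    (v : Fin 3 → Fin 3 → ℝ) (R : ℝ) (t : ℝ) (ht : 0 < t) (x y : ℝ) :
    (t * x, t * y) ∈ edgeCone r i v R ↔ (x, y) ∈ edgeCone r i v R := by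
  refine forall_congr' fun l => imp_congr_right fun _ => ?_
  rw [show (edgeVector r i l ⬝ᵥ v 1) * (t * x) + (edgeVector r i l ⬝ᵥ v 2) * (t * y) =
    t * ((edgeVector r i l ⬝ᵥ v 1) * x + (edgeVector r i l ⬝ᵥ v 2) * y) by ring,
    show R * (t * x) = t * (R * x) by ring]
  exact mul_le_mul_iff_right₀ ht

theorem edgeGain_eq_coneGain {ι : Type*} {r : ι → Fin 3 → ℝ} (hr : ∀ i, r i ⬝ᵥ r i = 1)
    {i j : ι} (hij : i ≠ j) {v : Fin 3 → Fin 3 → ℝ} {R : ℝ}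
    (hv : ∀ i j, v i ⬝ᵥ v j = if i = j then 1 else 0) (hv0 : v 0 = r i)
    (hR : edgeVector r i j = R • v 1) (x : Fin 3 → ℝ) :
    edgeGain r i j x = coneGain R (edgeCone r i v R) (x ⬝ᵥ v 0, x ⬝ᵥ v 1, x ⬝ᵥ v 2) := by
  have h1 : x ⬝ᵥ edgeVector r i j = R * (x ⬝ᵥ v 1) := by rw [hR, dotProduct_smul, smul_eq_mul]
  have h2 : ∀ l, x ⬝ᵥ edgeVector r i l =
      (edgeVector r i l ⬝ᵥ v 1) * (x ⬝ᵥ v 1) + (edgeVector r i l ⬝ᵥ v 2) * (x ⬝ᵥ v 2) := by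
    intro l
    rw [dotProduct_eq_sum_frame hv, Fin.sum_univ_three, hv0, dotProduct_comm _ (r i),
      dotProduct_comm _ (r i), dotProduct_edgeVector hr]
    ring
  have h3 : x ∈ {x | i ≠ j ∧ ∀ l, i ≠ l → x ⬝ᵥ edgeVector r i l ≤ x ⬝ᵥ edgeVector r i j} ↔
      (x ⬝ᵥ v 1, x ⬝ᵥ v 2) ∈ edgeCone r i v R := by
    simp only [edgeCone, Set.mem_ofPred_eq, h1, and_iff_right hij]
    exact forall₂_congr fun l _ => by rw [h2]
  have h4 : x ∈ {x | x ⬝ᵥ edgeVector r i j ≤ x ⬝ᵥ r i} ↔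
      x ⬝ᵥ v 0 ∈ Set.Ici (R * (x ⬝ᵥ v 1)) := by
    rw [Set.mem_ofPred_eq, Set.mem_Ici, h1, hv0]
  unfold edgeGain coneGain
  by_cases hP : (x ⬝ᵥ v 1, x ⬝ᵥ v 2) ∈ edgeCone r i v R
  · rw [Set.indicator_of_mem hP, Set.indicator_of_mem (h3.2 hP)]
    by_cases hQ : x ⬝ᵥ v 0 ∈ Set.Ici (R * (x ⬝ᵥ v 1))
    · rw [Set.indicator_of_mem hQ, Set.indicator_of_mem (h4.2 hQ), hv0]
    · rw [Set.indicator_of_notMem hQ, Set.indicator_of_notMem (h4.not.2 hQ)]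
  · rw [Set.indicator_of_notMem hP, Set.indicator_of_notMem (h3.not.2 hP)]

theorem exists_edge_frame {ι : Type*} {r : ι → Fin 3 → ℝ} (hr : ∀ i, r i ⬝ᵥ r i = 1) (i j : ι) :
    ∃ (v : Fin 3 → Fin 3 → ℝ) (R : ℝ), (∀ i j, v i ⬝ᵥ v j = if i = j then 1 else 0) ∧
      v 0 = r i ∧ 0 ≤ R ∧ edgeVector r i j = R • v 1 :=
  exists_frame (hr i) (dotProduct_edgeVector hr i j)

theorem integral_edgeGain_eq {ι : Type*} [Finite ι] {r : ι → Fin 3 → ℝ}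
    (hr : ∀ i, r i ⬝ᵥ r i = 1) {i j : ι} (hij : i ≠ j) {v : Fin 3 → Fin 3 → ℝ} {R : ℝ}
    (hv : ∀ i j, v i ⬝ᵥ v j = if i = j then 1 else 0) (hv0 : v 0 = r i)
    (hR : edgeVector r i j = R • v 1) :
    ∫ x, edgeGain r i j x ∂(Measure.pi fun _ : Fin 3 => gaussianReal 0 1) =
      ∫ x, coneGain R (edgeCone r i v R) x
        ∂((gaussianReal 0 1).prod ((gaussianReal 0 1).prod (gaussianReal 0 1))) := by
  have hT := measurePreserving_gaussian_frame hv
  simp_rw [edgeGain_eq_coneGain hr hij hv hv0 hR]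
  rw [← hT.map_eq, integral_map hT.measurable.aemeasurable
    (measurable_coneGain R (measurableSet_edgeCone r i v R)).aestronglyMeasurable]

theorem integrable_edgeGain {ι : Type*} [Finite ι] {r : ι → Fin 3 → ℝ}
    (hr : ∀ i, r i ⬝ᵥ r i = 1) (i j : ι) :
    Integrable (edgeGain r i j) (Measure.pi fun _ : Fin 3 => gaussianReal 0 1) := by
  by_cases hij : i = j
  · subst hij
    rw [funext (edgeGain_self r i)]
    exact integrable_zero _ _ _
  · obtain ⟨v, R, hv, hv0, -, hR⟩ := exists_edge_frame hr i j
    rw [funext (edgeGain_eq_coneGain hr hij hv hv0 hR)]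
    exact (measurePreserving_gaussian_frame hv).integrable_comp_of_integrable
      (integrable_coneGain R (measurableSet_edgeCone r i v R))

theorem integral_edgeGain_le {ι : Type*} [Finite ι] {r : ι → Fin 3 → ℝ}
    (hr : ∀ i, r i ⬝ᵥ r i = 1) (i j : ι) :
    ∫ x, edgeGain r i j x ∂(Measure.pi fun _ : Fin 3 => gaussianReal 0 1) ≤
      halfEdge / Real.pi := by
  by_cases hij : i = j
  · subst hij
    simp only [edgeGain_self, integral_zero]
    exact div_nonneg halfEdge_nonneg Real.pi_pos.le
  · obtain ⟨v, R, hv, hv0, hR0, hR⟩ := exists_edge_frame hr i j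
    rw [integral_edgeGain_eq hr hij hv hv0 hR]
    exact integral_coneGain_le hR0 (measurableSet_edgeCone r i v R) (smul_mem_edgeCone r i v R)

theorem ae_edgeVector_ne {ι : Type*} [Finite ι] {r : ι → Fin 3 → ℝ}
    (hr : ∀ i, r i ⬝ᵥ r i = 1) (hinj : Function.Injective r) :
    ∀ᵐ x ∂(Measure.pi fun _ : Fin 3 => gaussianReal 0 1), ∀ i j l, i ≠ j → i ≠ l → j ≠ l →
      x ⬝ᵥ edgeVector r i j ≠ x ⬝ᵥ edgeVector r i l := by
  simp only [ae_all_iff]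
  intro i j l hj hl hjl
  have : edgeVector r i j - edgeVector r i l ≠ 0 :=
    sub_ne_zero.2 fun h => hjl (edgeVector_injOn hr hinj hj hl h)
  filter_upwards [ae_dotProduct_ne_zero this] with x hx h
  rw [dotProduct_sub, h, sub_self] at hx
  exact hx rfl

theorem ae_dotProduct_ne {ι : Type*} [Finite ι] {r : ι → Fin 3 → ℝ}
    (hinj : Function.Injective r) :
    ∀ᵐ x ∂(Measure.pi fun _ : Fin 3 => gaussianReal 0 1), ∀ i j, i ≠ j →
      x ⬝ᵥ r i ≠ x ⬝ᵥ r j := by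
  simp only [ae_all_iff]
  intro i j hij
  filter_upwards [ae_dotProduct_ne_zero (sub_ne_zero.2 (hinj.ne hij))] with x hx h
  rw [dotProduct_sub, h, sub_self] at hx
  exact hx rfl

theorem integral_edgeGain_eq_zero {ι : Type*} [Finite ι] {r : ι → Fin 3 → ℝ}
    (hr : ∀ i, r i ⬝ᵥ r i = 1) (hinj : Function.Injective r) {i j : ι}
    (h : ¬ IsStrictEdge r i j) :
    ∫ x, edgeGain r i j x ∂(Measure.pi fun _ : Fin 3 => gaussianReal 0 1) = 0 := by
  refine integral_eq_zero_of_ae ?_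
  filter_upwards [ae_edgeVector_ne hr hinj] with x hx
  refine Set.indicator_of_notMem (fun hmem => h ?_) _
  obtain ⟨hij, hmax⟩ := hmem
  set t := x ⬝ᵥ edgeVector r i j with ht
  have hu : ∀ y, (x - (x ⬝ᵥ r i) • r i + t • r i) ⬝ᵥ y =
      x ⬝ᵥ y - (x ⬝ᵥ r i) * (r i ⬝ᵥ y) + t * (r i ⬝ᵥ y) := by
    intro y; simp [add_dotProduct, sub_dotProduct, smul_dotProduct]
  have hlt : ∀ l, i ≠ l → r i ⬝ᵥ r l < 1 := fun l hl =>
    dotProduct_lt_one (hr i) (hr l) (hinj.ne hl)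
  refine ⟨x - (x ⬝ᵥ r i) • r i + t • r i, ?_, fun l hli hlj => ?_⟩
  · rw [dotProduct_eq_edgeVector_add (hlt j hij) _, hu, hu, dotProduct_edgeVector hr, hr, ← ht]
    ring
  · have h1 := (hmax l hli.symm).lt_of_ne (hx i l j hli.symm hij hlj)
    rw [dotProduct_eq_edgeVector_add (hlt l hli.symm) _, hu, hu, dotProduct_edgeVector hr, hr]
    nlinarith [hlt l hli.symm]

theorem sum_edgeGain {ι : Type*} [Fintype ι] [Nontrivial ι] {r : ι → Fin 3 → ℝ}
    (hr : ∀ i, r i ⬝ᵥ r i = 1) (hinj : Function.Injective r) {x : Fin 3 → ℝ}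
    (hx : ∀ i j, i ≠ j → x ⬝ᵥ r i ≠ x ⬝ᵥ r j)
    (hx' : ∀ i j l, i ≠ j → i ≠ l → j ≠ l → x ⬝ᵥ edgeVector r i j ≠ x ⬝ᵥ edgeVector r i l) :
    ∑ i, ∑ j, edgeGain r i j x =
      √(2 * Real.pi) * (⨆ i, x ⬝ᵥ r i) - 2 * (hiCos + loCos) - Fintype.card ι * arcCharge := by
  classical
  have hlt : ∀ i l, i ≠ l → r i ⬝ᵥ r l < 1 := fun i l hl =>
    dotProduct_lt_one (hr i) (hr l) (hinj.ne hl)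
  have inner : ∀ i, ∑ j, edgeGain r i j x =
      (if ∀ l, x ⬝ᵥ r l ≤ x ⬝ᵥ r i then
        √(2 * Real.pi) * (x ⬝ᵥ r i) - 2 * (hiCos + loCos) else 0) - arcCharge := by
    intro i
    have hne : (Finset.univ.erase i).Nonempty := by
      obtain ⟨j, hj⟩ := exists_ne i
      exact ⟨j, by simp [hj]⟩
    obtain ⟨j, hj, hmax⟩ := Finset.exists_max_image _ (fun l => x ⬝ᵥ edgeVector r i l) hne
    have hij : i ≠ j := (Finset.ne_of_mem_erase hj).symm
    have hmax : ∀ l, i ≠ l → x ⬝ᵥ edgeVector r i l ≤ x ⬝ᵥ edgeVector r i j :=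
      fun l hl => hmax l (by simp [hl.symm])
    rw [Finset.sum_eq_single_of_mem j (Finset.mem_univ j)]
    · have hiff : (∀ l, x ⬝ᵥ r l ≤ x ⬝ᵥ r i) ↔ x ⬝ᵥ edgeVector r i j ≤ x ⬝ᵥ r i := by
        refine ⟨fun h => (dotProduct_edgeVector_le_iff (hlt i j hij) x).2 (h j), fun h l => ?_⟩
        rcases eq_or_ne i l with rfl | hl
        · exact le_rfl
        · exact (dotProduct_edgeVector_le_iff (hlt i l hl) x).1 ((hmax l hl).trans h)
      simp only [edgeGain, Set.indicator, Set.mem_ofPred_eq, hiff]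
      rw [if_pos ⟨hij, hmax⟩]
    · intro l _ hlj
      refine Set.indicator_of_notMem ?_ _
      rintro ⟨hil, hl⟩
      exact hx' i l j hil hij hlj (le_antisymm (hmax l hil) (hl j hij))
  obtain ⟨i, hi⟩ := Finite.exists_max (fun i => x ⬝ᵥ r i)
  have hsup : (⨆ i, x ⬝ᵥ r i) = x ⬝ᵥ r i :=
    le_antisymm (ciSup_le hi) (le_ciSup (f := fun i => x ⬝ᵥ r i) (Set.finite_range _).bddAbove i)
  simp_rw [inner]
  rw [Finset.sum_sub_distrib, Finset.sum_eq_single_of_mem i (Finset.mem_univ i), if_pos hi, hsup]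
  · simp
  · intro l _ hl
    exact if_neg fun h => hx l i hl (le_antisymm (hi l) (h i))

theorem integral_iSup_dotProduct {ι : Type*} [Fintype ι] [Nontrivial ι] {r : ι → Fin 3 → ℝ}
    (hr : ∀ i, r i ⬝ᵥ r i = 1) (hinj : Function.Injective r) :
    √(2 * Real.pi) * ∫ x, (⨆ i, x ⬝ᵥ r i) ∂(Measure.pi fun _ : Fin 3 => gaussianReal 0 1) =
      2 * (hiCos + loCos) + Fintype.card ι * arcCharge +
      ∑ i, ∑ j, ∫ x, edgeGain r i j x ∂(Measure.pi fun _ : Fin 3 => gaussianReal 0 1) := by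
  have hint : ∀ i, Integrable (fun x => ∑ j, edgeGain r i j x)
      (Measure.pi fun _ : Fin 3 => gaussianReal 0 1) := fun i =>
    integrable_finsetSum _ fun j _ => integrable_edgeGain hr i j
  have h1 : ∀ i, ∑ j, ∫ x, edgeGain r i j x ∂(Measure.pi fun _ : Fin 3 => gaussianReal 0 1) =
      ∫ x, ∑ j, edgeGain r i j x ∂(Measure.pi fun _ : Fin 3 => gaussianReal 0 1) := fun i =>
    (integral_finsetSum _ fun j _ => integrable_edgeGain hr i j).symm
  simp_rw [h1]
  rw [← integral_finsetSum _ fun i _ => hint i, ← integral_const_mul]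
  have h2 : ∀ᵐ x ∂(Measure.pi fun _ : Fin 3 => gaussianReal 0 1),
      √(2 * Real.pi) * (⨆ i, x ⬝ᵥ r i) = 2 * (hiCos + loCos) + Fintype.card ι * arcCharge +
        ∑ i, ∑ j, edgeGain r i j x := by
    filter_upwards [ae_dotProduct_ne hinj, ae_edgeVector_ne hr hinj] with x hx hx'
    rw [sum_edgeGain hr hinj hx hx']
    ring
  rw [integral_congr_ae h2, integral_add (integrable_const _)
    (integrable_finsetSum _ fun i _ => hint i)]
  simp

/-- The coefficients `a` form an affine dependency of the points `r`. -/
def IsAffineDependency {ι : Type*} [Fintype ι] (r : ι → Fin 3 → ℝ) (a : ι → ℝ) : Prop :=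
  ∑ l, a l = 0 ∧ ∑ l, a l • r l = 0

theorem IsAffineDependency.neg {ι : Type*} [Fintype ι] {r : ι → Fin 3 → ℝ} {a : ι → ℝ}
    (ha : IsAffineDependency r a) : IsAffineDependency r (-a) := by
  simpa [IsAffineDependency] using ha

theorem IsAffineDependency.add_smul {ι : Type*} [Fintype ι] {r : ι → Fin 3 → ℝ} {a b : ι → ℝ}
    (ha : IsAffineDependency r a) (hb : IsAffineDependency r b) (t : ℝ) :
    IsAffineDependency r (a + t • b) := by
  obtain ⟨h1, h2⟩ := ha
  obtain ⟨h3, h4⟩ := hb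
  constructor
  · simp [Finset.sum_add_distrib, ← Finset.mul_sum, h1, h3]
  · have h : ∀ l, (a + t • b) l • r l = a l • r l + t • (b l • r l) := by
      intro l
      simp [_root_.add_smul, mul_smul]
    simp_rw [h]
    rw [Finset.sum_add_distrib, ← Finset.smul_sum, h2, h4, smul_zero, add_zero]

theorem IsAffineDependency.sum_mul_eq_zero {ι : Type*} [Fintype ι] {r : ι → Fin 3 → ℝ} {a : ι → ℝ}
    (ha : IsAffineDependency r a) (u : Fin 3 → ℝ) (s : ℝ) :
    ∑ l, a l * (u ⬝ᵥ r l - s) = 0 := by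
  have h := congrArg (fun y => u ⬝ᵥ y) ha.2
  simp only [dotProduct_sum, dotProduct_smul, smul_eq_mul, dotProduct_zero] at h
  simp_rw [mul_sub]
  rw [Finset.sum_sub_distrib, h, ← Finset.sum_mul, ha.1]
  ring

theorem IsAffineDependency.eq_zero_of_nonpos {ι : Type*} [Fintype ι] {r : ι → Fin 3 → ℝ}
    (hr : ∀ i, r i ⬝ᵥ r i = 1) (hinj : Function.Injective r) {a : ι → ℝ}
    (ha : IsAffineDependency r a) (i : ι) (h : ∀ l, l ≠ i → a l ≤ 0) : a = 0 := by
  have hlt : ∀ l, l ≠ i → r i ⬝ᵥ r l < 1 := fun l hl =>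
    dotProduct_lt_one (hr i) (hr l) (hinj.ne hl.symm)
  have hnn : ∀ l ∈ Finset.univ, 0 ≤ a l * (r i ⬝ᵥ r l - 1) := by
    intro l _
    rcases eq_or_ne l i with rfl | hl
    · simp [hr]
    · exact mul_nonneg_of_nonpos_of_nonpos (h l hl) (by linarith [hlt l hl])
  have h0 := (Finset.sum_eq_zero_iff_of_nonneg hnn).1 (ha.sum_mul_eq_zero (r i) 1)
  have hz : ∀ l, l ≠ i → a l = 0 := fun l hl =>
    (mul_eq_zero.1 (h0 l (Finset.mem_univ l))).resolve_right (by linarith [hlt l hl])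
  funext l
  rcases eq_or_ne l i with rfl | hl
  · exact (Finset.sum_eq_single_of_mem l (Finset.mem_univ l) fun k _ hk => hz k hk).symm.trans
      ha.1
  · exact hz l hl

theorem IsAffineDependency.not_isStrictEdge {ι : Type*} [Fintype ι] {r : ι → Fin 3 → ℝ}
    (hr : ∀ i, r i ⬝ᵥ r i = 1) (hinj : Function.Injective r) {a : ι → ℝ}
    (ha : IsAffineDependency r a) (ha0 : a ≠ 0) {i j : ι}
    (h : ∀ l, l ≠ i → l ≠ j → a l ≤ 0) : ¬ IsStrictEdge r i j := by
  rintro ⟨u, hu, hlt⟩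
  have hnn : ∀ l ∈ Finset.univ, 0 ≤ a l * (u ⬝ᵥ r l - u ⬝ᵥ r i) := by
    intro l _
    rcases eq_or_ne l i with rfl | hi
    · simp
    rcases eq_or_ne l j with rfl | hj
    · simp [hu]
    exact mul_nonneg_of_nonpos_of_nonpos (h l hi hj) (by linarith [hlt l hi hj])
  have h0 := (Finset.sum_eq_zero_iff_of_nonneg hnn).1 (ha.sum_mul_eq_zero u _)
  have hz : ∀ l, l ≠ i → l ≠ j → a l = 0 := fun l hi hj =>
    (mul_eq_zero.1 (h0 l (Finset.mem_univ l))).resolve_right (by linarith [hlt l hi hj])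
  rcases le_total (a j) 0 with hj | hj
  · exact ha0 (ha.eq_zero_of_nonpos hr hinj i fun l hl => by
      rcases eq_or_ne l j with rfl | hlj
      · exact hj
      · exact h l hl hlj)
  · refine ha0 (neg_eq_zero.1 (ha.neg.eq_zero_of_nonpos hr hinj i fun l hl => ?_))
    rcases eq_or_ne l j with rfl | hlj
    · simpa using hj
    · simp [hz l hl hlj]

theorem exists_isAffineDependency (r : Fin 6 → Fin 3 → ℝ) (l : Fin 6) :
    ∃ a, a ≠ 0 ∧ IsAffineDependency r a ∧ a l = 0 := by
  let L : (Fin 6 → ℝ) →ₗ[ℝ] (Fin 3 → ℝ) × ℝ × ℝ :=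
    (Fintype.linearCombination ℝ r).prod
      ((Fintype.linearCombination ℝ fun _ => (1 : ℝ)).prod (LinearMap.proj l))
  have hker : LinearMap.ker L ≠ ⊥ := LinearMap.ker_ne_bot_of_finrank_lt (by simp)
  obtain ⟨a, ha, ha0⟩ := (Submodule.ne_bot_iff _).1 hker
  have h : L a = 0 := ha
  simp only [Prod.ext_iff] at h
  refine ⟨a, ha0, ⟨?_, ?_⟩, h.2.2⟩
  · simpa [L, Fintype.linearCombination_apply] using h.2.1
  · simpa [L, Fintype.linearCombination_apply] using h.1

/-- Six points on the sphere have, for each point `l`, an affine dependency avoiding `l`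
whose positive part is supported on two points. -/
theorem exists_isAffineDependency_pair {r : Fin 6 → Fin 3 → ℝ} (hr : ∀ i, r i ⬝ᵥ r i = 1)
    (hinj : Function.Injective r) (l : Fin 6) :
    ∃ a i j, a ≠ 0 ∧ IsAffineDependency r a ∧ a l = 0 ∧ i ≠ j ∧ 0 < a i ∧ 0 < a j ∧
      ∀ k, k ≠ i → k ≠ j → a k ≤ 0 := by
  suffices H : ∀ a : Fin 6 → ℝ, a ≠ 0 → IsAffineDependency r a → a l = 0 →
      (Finset.univ.filter fun k => 0 < a k).card ≤ 2 →
      ∃ i j, i ≠ j ∧ 0 < a i ∧ 0 < a j ∧ ∀ k, k ≠ i → k ≠ j → a k ≤ 0 by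
    obtain ⟨a, ha0, ha, hal⟩ := exists_isAffineDependency r l
    have hcard : (Finset.univ.filter fun k => 0 < a k).card +
        (Finset.univ.filter fun k => 0 < (-a) k).card ≤ 5 := by
      rw [← Finset.card_union_of_disjoint]
      · refine (Finset.card_le_card (t := Finset.univ.erase l) fun k hk => ?_).trans (by simp)
        rw [Finset.mem_erase]
        refine ⟨?_, Finset.mem_univ k⟩
        rintro rfl
        simp [hal] at hk
      · rw [Finset.disjoint_filter]
        intro k _ h1 h2
        simp only [Pi.neg_apply] at h2
        linarith
    rcases le_or_gt (Finset.univ.filter fun k => 0 < a k).card 2 with h | h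
    · obtain ⟨i, j, h⟩ := H a ha0 ha hal h
      exact ⟨a, i, j, ha0, ha, hal, h⟩
    · obtain ⟨i, j, h⟩ := H (-a) (neg_ne_zero.2 ha0) ha.neg (by simp [hal]) (by omega)
      exact ⟨-a, i, j, neg_ne_zero.2 ha0, ha.neg, by simp [hal], h⟩
  intro a ha0 ha hal hcard
  have hmem : ∀ k, k ∉ (Finset.univ.filter fun k => 0 < a k) → a k ≤ 0 := by simp
  have h1 : 1 < (Finset.univ.filter fun k => 0 < a k).card := by
    by_contra! hle
    rw [Finset.card_le_one_iff_subset_singleton] at hle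
    obtain ⟨i, hi⟩ := hle
    exact ha0 (ha.eq_zero_of_nonpos hr hinj i fun k hk =>
      hmem k fun h => hk (Finset.mem_singleton.1 (hi h)))
  obtain ⟨i, j, hij, hS⟩ := Finset.card_eq_two.1 (le_antisymm hcard h1)
  refine ⟨i, j, hij, ?_, ?_, fun k hi hj => hmem k (by simp [hS, hi, hj])⟩
  · have : i ∈ Finset.univ.filter fun k => 0 < a k := by simp [hS]
    simpa using this
  · have : j ∈ Finset.univ.filter fun k => 0 < a k := by simp [hS]
    simpa using this

/-- The graph of pairs of points that do not span a strict edge of the convex hull. -/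
def nonEdgeGraph {ι : Type*} (r : ι → Fin 3 → ℝ) : SimpleGraph ι :=
  SimpleGraph.fromRel fun i j => ¬ IsStrictEdge r i j

theorem IsStrictEdge.symm {ι : Type*} {r : ι → Fin 3 → ℝ} {i j : ι} (h : IsStrictEdge r i j) :
    IsStrictEdge r j i := by
  obtain ⟨u, hu, hlt⟩ := h
  exact ⟨u, hu.symm, fun l hj hi => hu ▸ hlt l hi hj⟩

theorem nonEdgeGraph_adj {ι : Type*} {r : ι → Fin 3 → ℝ} {i j : ι} :
    (nonEdgeGraph r).Adj i j ↔ i ≠ j ∧ ¬ IsStrictEdge r i j := by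
  rw [nonEdgeGraph, SimpleGraph.fromRel_adj]
  refine and_congr_right fun _ => ⟨fun h => h.elim id fun h h' => h h'.symm, Or.inl⟩

theorem three_le_card_nonEdgeGraph {r : Fin 6 → Fin 3 → ℝ} (hr : ∀ i, r i ⬝ᵥ r i = 1)
    (hinj : Function.Injective r) [DecidableRel (nonEdgeGraph r).Adj] :
    3 ≤ (nonEdgeGraph r).edgeFinset.card := by
  by_contra! hcard
  have hpair : ∀ a : Fin 6 → ℝ, a ≠ 0 → IsAffineDependency r a → ∀ i j, i ≠ j →
      (∀ l, l ≠ i → l ≠ j → a l ≤ 0) → (nonEdgeGraph r).Adj i j := fun a ha0 ha i j hij h =>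
    nonEdgeGraph_adj.2 ⟨hij, ha.not_isStrictEdge hr hinj ha0 h⟩
  have htwo : ∀ a b c d e f, (nonEdgeGraph r).Adj a b → (nonEdgeGraph r).Adj c d →
      (nonEdgeGraph r).Adj e f → s(a, b) ≠ s(c, d) → s(e, f) = s(a, b) ∨ s(e, f) = s(c, d) := by
    intro a b c d e f h1 h2 h3 h12
    by_contra! h
    have h3 : 2 < (nonEdgeGraph r).edgeFinset.card :=
      Finset.two_lt_card.2 ⟨s(a, b), by simpa, s(c, d), by simpa, s(e, f), by simpa, h12,
        h.1.symm, h.2.symm⟩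
    omega
  have havoid : ∀ l, ∃ i j, (nonEdgeGraph r).Adj i j ∧ l ≠ i ∧ l ≠ j := by
    intro l
    obtain ⟨a, i, j, ha0, ha, hal, hij, hi, hj, h⟩ := exists_isAffineDependency_pair hr hinj l
    refine ⟨i, j, hpair a ha0 ha i j hij h, ?_, ?_⟩ <;> rintro rfl <;> linarith
  obtain ⟨p, q, m, n, hpq, hmn, hpm, hpn, hqm, hqn⟩ : ∃ p q m n, (nonEdgeGraph r).Adj p q ∧
      (nonEdgeGraph r).Adj m n ∧ p ≠ m ∧ p ≠ n ∧ q ≠ m ∧ q ≠ n := by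
    obtain ⟨p, q, hpq, -, -⟩ := havoid 0
    obtain ⟨m, n, hmn, hpm, hpn⟩ := havoid p
    obtain ⟨s, t, hst, hqs, hqt⟩ := havoid q
    have h1 : s(p, q) ≠ s(m, n) := by
      rw [ne_eq, Sym2.eq_iff]; grind
    have h2 := htwo p q m n s t hpq hmn hst h1
    rw [Sym2.eq_iff, Sym2.eq_iff] at h2
    exact ⟨p, q, m, n, hpq, hmn, hpm, hpn, by grind, by grind⟩
  have hne : s(p, q) ≠ s(m, n) := by
    rw [ne_eq, Sym2.eq_iff]; grind
  have hpq' := hpq.ne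
  have hmn' := hmn.ne
  obtain ⟨x, y, hxy, hS⟩ : ∃ x y, x ≠ y ∧ ({p, q, m, n} : Finset (Fin 6))ᶜ = {x, y} := by
    rw [← Finset.card_eq_two, Finset.card_compl, Finset.card_insert_of_notMem (by simp [*]),
      Finset.card_insert_of_notMem (by simp [*]), Finset.card_pair hmn']
    simp
  have hcover : ∀ k, k = p ∨ k = q ∨ k = m ∨ k = n ∨ k = x ∨ k = y := by
    intro k
    by_cases hk : k ∈ ({p, q, m, n} : Finset (Fin 6))
    · simp at hk; tauto
    · rw [← Finset.mem_compl, hS] at hk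
      simp at hk; tauto
  have hx : x ∉ ({p, q, m, n} : Finset (Fin 6)) := by
    rw [← Finset.mem_compl, hS]; simp
  have hy : y ∉ ({p, q, m, n} : Finset (Fin 6)) := by
    rw [← Finset.mem_compl, hS]; simp
  simp only [Finset.mem_insert, Finset.mem_singleton, not_or] at hx hy
  have key : ∀ e f, (nonEdgeGraph r).Adj e f →
      e = p ∧ f = q ∨ e = q ∧ f = p ∨ e = m ∧ f = n ∨ e = n ∧ f = m := by
    intro e f hef
    have := htwo p q m n e f hpq hmn hef hne
    rw [Sym2.eq_iff, Sym2.eq_iff] at this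
    tauto
  have hxy' : ∀ z w, (z = x ∨ z = y ∨ z = q) → (w = x ∨ w = y) → ¬ (nonEdgeGraph r).Adj z w := by
    intro z w hz hw h
    have := key z w h
    grind
  obtain ⟨a, i, j, ha0, ha, hap, hij, hi, hj, h⟩ := exists_isAffineDependency_pair hr hinj p
  have hmn_pos : 0 < a m ∧ 0 < a n ∧ a q ≤ 0 ∧ a x ≤ 0 ∧ a y ≤ 0 := by
    have := key i j (hpair a ha0 ha i j hij h)
    grind
  obtain ⟨ham, han, haq, hax, hay⟩ := hmn_pos
  have haq' : a q < 0 := lt_of_le_of_ne haq fun h0 =>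
    hxy' x y (by simp) (by simp) (hpair (-a) (neg_ne_zero.2 ha0) ha.neg x y hxy fun l _ _ => by
      rw [Pi.neg_apply]
      rcases hcover l with rfl | rfl | rfl | rfl | rfl | rfl <;>
        first | contradiction | linarith)
  have hax' : a x < 0 := lt_of_le_of_ne hax fun h0 =>
    hxy' q y (by simp) (by simp) (hpair (-a) (neg_ne_zero.2 ha0) ha.neg q y (by grind)
        fun l _ _ => by
      rw [Pi.neg_apply]
      rcases hcover l with rfl | rfl | rfl | rfl | rfl | rfl <;>
        first | contradiction | linarith)
  have hay' : a y < 0 := lt_of_le_of_ne hay fun h0 =>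
    hxy' q x (by simp) (by simp) (hpair (-a) (neg_ne_zero.2 ha0) ha.neg q x (by grind)
        fun l _ _ => by
      rw [Pi.neg_apply]
      rcases hcover l with rfl | rfl | rfl | rfl | rfl | rfl <;>
        first | contradiction | linarith)
  obtain ⟨c, i', j', hc0, hc, hcm, hij', hi', hj', h'⟩ := exists_isAffineDependency_pair hr hinj m
  have hpq_pos : 0 < c p ∧ 0 < c q ∧ c x ≤ 0 ∧ c y ≤ 0 := by
    have := key i' j' (hpair c hc0 hc i' j' hij' h')
    grind
  obtain ⟨hcp, hcq, hcx, hcy⟩ := hpq_pos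
  have ht : 0 < -(a q) / c q := div_pos (neg_pos.2 haq') hcq
  have hb := ha.add_smul hc (-(a q) / c q)
  set t := -(a q) / c q with ht_def
  have hbapp : ∀ k, (a + t • c) k = a k + t * c k := fun k => rfl
  have hbq : (a + t • c) q = 0 := by
    rw [hbapp, ht_def, div_mul_cancel₀ _ hcq.ne', add_neg_cancel]
  have hbp : 0 < (a + t • c) p := by rw [hbapp, hap, zero_add]; exact mul_pos ht hcp
  have hbm : 0 < (a + t • c) m := by rw [hbapp, hcm, mul_zero, add_zero]; exact ham
  have hbx : (a + t • c) x ≤ 0 := by rw [hbapp]; nlinarith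
  have hby : (a + t • c) y ≤ 0 := by rw [hbapp]; nlinarith
  have hb0 : a + t • c ≠ 0 := fun h0 => by rw [h0] at hbp; exact lt_irrefl _ hbp
  generalize a + t • c = b at *
  rcases le_total (b n) 0 with hbn | hbn
  · have := key p m (hpair b hb0 hb p m hpm fun l _ _ => by
      rcases hcover l with rfl | rfl | rfl | rfl | rfl | rfl <;>
        first | contradiction | linarith)
    grind
  · exact hxy' x y (by simp) (by simp) (hpair (-b) (neg_ne_zero.2 hb0) hb.neg x y hxy
        fun l _ _ => by
      rw [Pi.neg_apply]
      rcases hcover l with rfl | rfl | rfl | rfl | rfl | rfl <;>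
        first | contradiction | linarith)

theorem sum_integral_edgeGain_le {r : Fin 6 → Fin 3 → ℝ} (hr : ∀ i, r i ⬝ᵥ r i = 1)
    (hinj : Function.Injective r) :
    ∑ i, ∑ j, ∫ x, edgeGain r i j x ∂(Measure.pi fun _ : Fin 3 => gaussianReal 0 1) ≤
      24 * (halfEdge / Real.pi) := by
  classical
  have hnn : 0 ≤ halfEdge / Real.pi := div_nonneg halfEdge_nonneg Real.pi_pos.le
  have hle : ∀ i j, ∫ x, edgeGain r i j x ∂(Measure.pi fun _ : Fin 3 => gaussianReal 0 1) ≤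
      (1 - (if i = j then 1 else 0) - (if (nonEdgeGraph r).Adj i j then 1 else 0)) *
        (halfEdge / Real.pi) := by
    intro i j
    by_cases hij : i = j
    · subst hij
      simp [edgeGain_self]
    by_cases hadj : (nonEdgeGraph r).Adj i j
    · simp [hij, hadj, integral_edgeGain_eq_zero hr hinj (nonEdgeGraph_adj.1 hadj).2]
    · simpa [hij, hadj] using integral_edgeGain_le hr i j
  have hdeg : ∀ i, ∑ j, (if (nonEdgeGraph r).Adj i j then (1 : ℝ) else 0) =
      (nonEdgeGraph r).degree i := by
    intro i
    rw [Finset.sum_boole, ← SimpleGraph.card_neighborFinset_eq_degree,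
      SimpleGraph.neighborFinset_eq_filter]
  have hsum : ∑ i, ((nonEdgeGraph r).degree i : ℝ) = 2 * (nonEdgeGraph r).edgeFinset.card := by
    exact_mod_cast (nonEdgeGraph r).sum_degrees_eq_twice_card_edges
  have hthree : (3 : ℝ) ≤ (nonEdgeGraph r).edgeFinset.card := by
    exact_mod_cast three_le_card_nonEdgeGraph hr hinj
  calc _ ≤ ∑ i, ∑ j, (1 - (if i = j then 1 else 0) -
        (if (nonEdgeGraph r).Adj i j then 1 else 0)) * (halfEdge / Real.pi) :=
        Finset.sum_le_sum fun i _ => Finset.sum_le_sum fun j _ => hle i j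
    _ = (30 - 2 * (nonEdgeGraph r).edgeFinset.card) * (halfEdge / Real.pi) := by
        simp_rw [← Finset.sum_mul, Finset.sum_sub_distrib, hdeg, hsum]
        simp
        norm_num
    _ ≤ 24 * (halfEdge / Real.pi) := by gcongr; linarith

theorem integrable_iSup_dotProduct {ι : Type*} [Fintype ι] [Nonempty ι] (r : ι → Fin 3 → ℝ) :
    Integrable (fun x => ⨆ i, x ⬝ᵥ r i) (Measure.pi fun _ : Fin 3 => gaussianReal 0 1) := by
  have hid : Integrable (fun y : ℝ => y) (gaussianReal 0 1) :=
    memLp_one_iff_integrable.1 (memLp_id_gaussianReal 1)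
  have hint : ∀ i, Integrable (fun x => x ⬝ᵥ r i) (Measure.pi fun _ : Fin 3 => gaussianReal 0 1) :=
    fun i => integrable_finsetSum _ fun k _ =>
      (integrable_comp_eval (μ := fun _ : Fin 3 => gaussianReal 0 1) (i := k) (f := fun y => y)
        hid).mul_const (r i k)
  refine (integrable_finsetSum Finset.univ fun i _ => (hint i).abs).mono'
    (Measurable.iSup fun i => by unfold dotProduct; fun_prop).aestronglyMeasurable
    (Filter.Eventually.of_forall fun x => ?_)
  obtain ⟨i, hi⟩ := exists_eq_ciSup_of_finite (f := fun i => x ⬝ᵥ r i)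
  rw [← hi, Real.norm_eq_abs]
  exact Finset.single_le_sum (f := fun i => |x ⬝ᵥ r i|) (fun _ _ => abs_nonneg _)
    (Finset.mem_univ i)

theorem infinite_unit_dotProduct : {x : Fin 3 → ℝ | x ⬝ᵥ x = 1}.Infinite := by
  refine Set.infinite_of_injOn_mapsTo (s := Set.Icc 0 Real.pi)
    (f := fun θ => ![Real.cos θ, Real.sin θ, 0]) ?_ ?_ (Set.Icc_infinite Real.pi_pos)
  · intro θ hθ φ hφ h
    exact Real.injOn_cos hθ hφ (congrFun h 0)
  · intro θ _
    simp [← sq]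

theorem exists_injective_range_subset {n : ℕ} {r : Fin n → Fin 3 → ℝ}
    (hr : ∀ i, r i ⬝ᵥ r i = 1) : ∃ s : Fin n → Fin 3 → ℝ, (∀ i, s i ⬝ᵥ s i = 1) ∧
      Function.Injective s ∧ Set.range r ⊆ Set.range s := by
  have hcard : (Set.range r).ncard ≤ n := by
    rw [← Set.image_univ]
    exact (Set.ncard_image_le Set.finite_univ).trans (by simp)
  obtain ⟨S, hS, hS1, hSn⟩ := infinite_unit_dotProduct.exists_superset_ncard_eq
    (Set.range_subset_iff.2 hr) (Set.finite_range r) hcard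
  rcases Nat.eq_zero_or_pos n with rfl | hn
  · exact ⟨r, hr, fun i => i.elim0, subset_rfl⟩
  have hfin : Finite S := Set.finite_of_ncard_pos (hSn ▸ hn)
  let e := Finite.equivFinOfCardEq (α := S) hSn
  refine ⟨fun i => e.symm i, fun i => hS1 (e.symm i).2,
    Subtype.val_injective.comp e.symm.injective, fun x hx => ⟨e ⟨x, hS hx⟩, by simp⟩⟩

theorem octaVertex_dotProduct (p q : Fin 3 × Bool) : octaVertex p ⬝ᵥ octaVertex q =
    if p.1 = q.1 then (if p.2 = q.2 then 1 else -1) else 0 := by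
  obtain ⟨a, s⟩ := p
  obtain ⟨b, t⟩ := q
  simp only [dotProduct, octaVertex, ite_mul, zero_mul, Finset.sum_ite_eq', Finset.mem_univ,
    if_true]
  cases s <;> cases t <;> simp

theorem octaVertex_injective : Function.Injective octaVertex := by
  intro p q h
  have h1 := octaVertex_dotProduct p q
  rw [h, octaVertex_dotProduct] at h1
  by_cases h2 : p.1 = q.1 <;> by_cases h3 : p.2 = q.2 <;> simp [h2, h3] at h1
  · exact Prod.ext h2 h3
  · norm_num at h1

theorem edgeVector_octaVertex (p q : Fin 3 × Bool) (hpq : p ≠ q) :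
    edgeVector octaVertex p q = if p.1 = q.1 then 0 else octaVertex q := by
  rw [edgeVector, octaVertex_dotProduct]
  by_cases h : p.1 = q.1
  · have h2 : p.2 ≠ q.2 := fun h2 => hpq (Prod.ext h h2)
    have h3 : octaVertex q = - octaVertex p := by
      funext k
      obtain ⟨a, s⟩ := p
      obtain ⟨b, t⟩ := q
      obtain rfl : a = b := h
      by_cases hk : k = a <;> cases s <;> cases t <;> simp_all [octaVertex]
    simp [h, h2, h3]
  · simp [h]

theorem Ioo_inter_abs_sin_le_cos :
    Set.Ioo (-Real.pi) Real.pi ∩ {θ | |Real.sin θ| ≤ Real.cos θ} =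
      Set.Icc (-(Real.pi / 4)) (Real.pi / 4) := by
  have hpi := Real.pi_pos
  have h2 : 0 < √2 / 2 := by positivity
  have hsub : ∀ θ, Real.sin (Real.pi / 4 - θ) = √2 / 2 * (Real.cos θ - Real.sin θ) := by
    intro θ
    rw [Real.sin_sub, Real.sin_pi_div_four, Real.cos_pi_div_four]
    ring
  have hadd : ∀ θ, Real.sin (Real.pi / 4 + θ) = √2 / 2 * (Real.cos θ + Real.sin θ) := by
    intro θ
    rw [Real.sin_add, Real.sin_pi_div_four, Real.cos_pi_div_four]
    ring
  ext θ
  simp only [Set.mem_inter_iff, Set.mem_Ioo, Set.mem_ofPred_eq, Set.mem_Icc, abs_le]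
  constructor
  · rintro ⟨⟨h3, h4⟩, h5, h6⟩
    constructor
    · by_contra! h
      have := Real.sin_neg_of_neg_of_neg_pi_lt (x := Real.pi / 4 + θ) (by linarith) (by linarith)
      rw [hadd] at this
      nlinarith
    · by_contra! h
      have := Real.sin_neg_of_neg_of_neg_pi_lt (x := Real.pi / 4 - θ) (by linarith) (by linarith)
      rw [hsub] at this
      nlinarith
  · rintro ⟨h3, h4⟩
    have h5 := Real.sin_nonneg_of_nonneg_of_le_pi (x := Real.pi / 4 + θ) (by linarith) (by linarith)
    have h6 := Real.sin_nonneg_of_nonneg_of_le_pi (x := Real.pi / 4 - θ) (by linarith) (by linarith)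
    rw [hadd] at h5
    rw [hsub] at h6
    have h7 := nonneg_of_mul_nonneg_right h5 h2
    have h8 := nonneg_of_mul_nonneg_right h6 h2
    exact ⟨⟨by linarith, by linarith⟩, by linarith, by linarith⟩

theorem setIntegral_quarter_cosDefect :
    ∫ θ in Set.Icc (-(Real.pi / 4)) (Real.pi / 4), cosDefect (Real.cos θ) = 2 * halfEdge := by
  have hcont : Continuous fun θ => cosDefect (Real.cos θ) :=
    continuous_cosDefect.comp Real.continuous_cos
  have hpi := Real.pi_pos
  have hneg : ∫ θ in -(Real.pi / 4)..0, cosDefect (Real.cos θ) = halfEdge := by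
    have := intervalIntegral.integral_comp_neg (a := 0) (b := Real.pi / 4)
      fun θ => cosDefect (Real.cos θ)
    simp only [Real.cos_neg, neg_zero] at this
    rw [← this, integral_cosDefect_one]
  rw [integral_Icc_eq_integral_Ioc, ← intervalIntegral.integral_of_le (by linarith),
    ← intervalIntegral.integral_add_adjacent_intervals (b := 0) (hcont.intervalIntegrable _ _)
      (hcont.intervalIntegrable _ _), hneg, integral_cosDefect_one]
  ring

theorem integral_edgeGain_octaVertex {p q : Fin 3 × Bool} (h : p.1 ≠ q.1) :
    ∫ x, edgeGain octaVertex p q x ∂(Measure.pi fun _ : Fin 3 => gaussianReal 0 1) =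
      halfEdge / Real.pi := by
  have hr : ∀ p, octaVertex p ⬝ᵥ octaVertex p = 1 := fun p => by simp [octaVertex_dotProduct]
  have hpq : p ≠ q := fun h' => h (h' ▸ rfl)
  obtain ⟨k, hkp, hkq⟩ : ∃ k, k ≠ p.1 ∧ k ≠ q.1 := by
    have : ∀ a b : Fin 3, ∃ k, k ≠ a ∧ k ≠ b := by decide
    exact this _ _
  have hv : ∀ i j, ![octaVertex p, octaVertex q, octaVertex (k, true)] i ⬝ᵥ
      ![octaVertex p, octaVertex q, octaVertex (k, true)] j = if i = j then 1 else 0 := by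
    intro i j
    fin_cases i <;> fin_cases j <;>
      simp [octaVertex_dotProduct, h, h.symm, hkp, hkq, hkp.symm, hkq.symm]
  set v := ![octaVertex p, octaVertex q, octaVertex (k, true)] with hvdef
  have hcone : ∀ w, w ∈ edgeCone octaVertex p v 1 ↔ |w.2| ≤ w.1 := by
    rintro ⟨x, y⟩
    simp only [edgeCone, Set.mem_ofPred_eq, hvdef]
    constructor
    · intro H
      have h1 := H (k, true) (by grind)
      have h2 := H (k, false) (by grind)
      rw [edgeVector_octaVertex _ _ (by grind)] at h1 h2
      simp [hkp.symm, octaVertex_dotProduct, hkq] at h1 h2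
      rw [abs_le]
      constructor <;> linarith
    · intro H l hl
      have h0 := (abs_nonneg y).trans H
      rw [abs_le] at H
      rw [edgeVector_octaVertex _ _ hl]
      obtain ⟨a, s⟩ := l
      have ha : a = p.1 ∨ a = q.1 ∨ a = k := by
        have : ∀ a b c d : Fin 3, a ≠ b → c ≠ a → c ≠ b → d = a ∨ d = b ∨ d = c := by decide
        exact this _ _ _ _ h hkp hkq
      rcases ha with rfl | rfl | rfl
      · simpa using h0
      · simp [h, octaVertex_dotProduct, hkq.symm]
        split_ifs <;> linarith
      · simp [hkp.symm, octaVertex_dotProduct, hkq]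
        split_ifs <;> linarith
  rw [integral_edgeGain_eq hr hpq hv rfl (R := 1) (by simp [edgeVector_octaVertex _ _ hpq, h, v]),
    integral_coneGain _ (measurableSet_edgeCone _ _ _ _) (smul_mem_edgeCone _ _ _ _)]
  simp only [hcone, one_mul]
  rw [setIntegral_indicator, Ioo_inter_abs_sin_le_cos, setIntegral_quarter_cosDefect]
  · field_simp
  · exact measurableSet_le (by fun_prop) (by fun_prop)

theorem not_isStrictEdge_octaVertex {p q : Fin 3 × Bool} (h : p.1 = q.1) (hpq : p ≠ q) :
    ¬ IsStrictEdge octaVertex p q := by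
  rintro ⟨u, hu, hlt⟩
  have hneg : ∀ a, octaVertex (a, false) = - octaVertex (a, true) := by
    intro a
    funext k
    by_cases hk : k = a <;> simp [octaVertex, hk]
  obtain ⟨k, hk⟩ : ∃ k, k ≠ p.1 := exists_ne p.1
  have h1 := hlt (k, true) (by grind) (by grind)
  have h2 := hlt (k, false) (by grind) (by grind)
  rw [hneg, dotProduct_neg] at h2
  obtain ⟨a, s⟩ := p
  obtain ⟨b, t⟩ := q
  obtain rfl : a = b := h
  cases s <;> cases t <;> simp [hneg] at hu hpq h1 h2 <;> linarith

theorem sum_integral_edgeGain_octaVertex :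
    ∑ p, ∑ q, ∫ x, edgeGain octaVertex p q x ∂(Measure.pi fun _ : Fin 3 => gaussianReal 0 1) =
      24 * (halfEdge / Real.pi) := by
  have hr : ∀ p, octaVertex p ⬝ᵥ octaVertex p = 1 := fun p => by simp [octaVertex_dotProduct]
  have hterm : ∀ p q : Fin 3 × Bool,
      ∫ x, edgeGain octaVertex p q x ∂(Measure.pi fun _ : Fin 3 => gaussianReal 0 1) =
        (if p.1 = q.1 then 0 else 1) * (halfEdge / Real.pi) := by
    intro p q
    by_cases h : p.1 = q.1
    · rw [if_pos h, zero_mul]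
      by_cases hpq : p = q
      · simp [hpq, edgeGain_self]
      · exact integral_edgeGain_eq_zero hr octaVertex_injective (not_isStrictEdge_octaVertex h hpq)
    · rw [integral_edgeGain_octaVertex h, if_neg h, one_mul]
  simp_rw [hterm, ← Finset.sum_mul, Fintype.sum_prod_type, Fin.sum_univ_three, Fintype.sum_bool]
  norm_num [Fin.ext_iff]

/-- Among all sextuples of unit vectors in `ℝ³`, the vertex set of the
regular octahedron maximizes the Gaussian mean width:
`E max_i ⟨g, r_i⟩ ≤ E max_{v ∈ {±e₁,±e₂,±e₃}} ⟨g, v⟩` for a standard Gaussian `g`. -/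
theorem octahedron_max_gaussian_mean_width
    (r : Fin 6 → Fin 3 → ℝ) (hr : ∀ i, r i ⬝ᵥ r i = 1) :
    (∫ x, (⨆ i, x ⬝ᵥ r i) ∂(Measure.pi fun _ : Fin 3 => gaussianReal 0 1)) ≤
      ∫ x, (⨆ p : Fin 3 × Bool, x ⬝ᵥ octaVertex p)
        ∂(Measure.pi fun _ : Fin 3 => gaussianReal 0 1) := by
  obtain ⟨s, hs, hinj, hrs⟩ := exists_injective_range_subset hr
  refine (integral_mono (integrable_iSup_dotProduct r) (integrable_iSup_dotProduct s)
    fun x => ciSup_le fun i => ?_).trans ?_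
  · obtain ⟨j, hj⟩ := hrs ⟨i, rfl⟩
    rw [← hj]
    exact le_ciSup (f := fun i => x ⬝ᵥ s i) (Set.finite_range _).bddAbove j
  · refine le_of_mul_le_mul_left ?_ (Real.sqrt_pos.2 Real.two_pi_pos)
    rw [integral_iSup_dotProduct hs hinj, integral_iSup_dotProduct
      (fun p => by simp [octaVertex_dotProduct]) octaVertex_injective,
      sum_integral_edgeGain_octaVertex]
    simpa using sum_integral_edgeGain_le hs hinj
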